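/- Let d = 2^ℓ, let ε, δ ∈ (0, 1/2), and let 𝒲 ⊂ ℝ^d be an arbitrary bounded set with diameter Diam(𝒲). Define h(x) = √(2/(md)) · cos(h̃(x) + b) ∈ ℝ^{md}, where cos is applied entrywise and b ∈ ℝ^{md} has i.i.d. entries uniform on [0, 2π], independent of the diagonal matrices. There are absolute constants C, c > 0 such that if m ≥ C ε⁻² (1 + Diam(𝒲))² log^c(d(1 + Diam(𝒲))/(εδ)), then with probability at least 1 − δ, for all x, y ∈ 𝒲, |⟨h(x), h(y)⟩ − exp(−‖x − y‖²/2)| ≤ ε. -/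

import Mathlib

open MeasureTheory ProbabilityTheory Real
open scoped ENNReal NNReal Classical

noncomputable section

/-- The Sylvester–Hadamard matrix of size `2^ℓ`: `H 0 = [1]`,
`H (ℓ+1) = [[H ℓ, H ℓ],[H ℓ, -H ℓ]]`. -/
def Had : ∀ ℓ : ℕ, Matrix (Fin (2 ^ ℓ)) (Fin (2 ^ ℓ)) ℝ
  | 0 => 1
  | (ℓ + 1) =>
      Matrix.reindex (finSumFinEquiv.trans (finCongr (by rw [pow_succ, mul_two])))
        (finSumFinEquiv.trans (finCongr (by rw [pow_succ, mul_two])))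
        (Matrix.fromBlocks (Had ℓ) (Had ℓ) (Had ℓ) (-(Had ℓ)))

/-- `rht ℓ m D z j k = (H_d D^j z)_k`, the `(j,k)` entry of the randomized Hadamard
transform of `z`, where `D j` records the diagonal entries of the diagonal matrix `D^j`. -/
def rht (ℓ m : ℕ) (D : Fin m → Fin (2 ^ ℓ) → ℝ) (z : EuclideanSpace ℝ (Fin (2 ^ ℓ)))
    (j : Fin m) (k : Fin (2 ^ ℓ)) : ℝ :=
  (Had ℓ).mulVec (fun i => D j i * z i) k

/-- The joint law of the diagonal entries of `D^1, …, D^m`: i.i.d. standard Gaussians. -/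
def diagMeasure (ℓ m : ℕ) : Measure (Fin m → Fin (2 ^ ℓ) → ℝ) :=
  Measure.pi fun _ => Measure.pi fun _ => gaussianReal 0 1

/-- The joint law of the phases `b^j_k`: i.i.d. uniform on `[0, 2π]`. -/
def phaseMeasure (ℓ m : ℕ) : Measure (Fin m → Fin (2 ^ ℓ) → ℝ) :=
  Measure.pi fun _ => Measure.pi fun _ =>
    (ENNReal.ofReal (2 * Real.pi))⁻¹ • volume.restrict (Set.Icc (0 : ℝ) (2 * Real.pi))

theorem Had_sq (ℓ : ℕ) (k i : Fin (2 ^ ℓ)) : Had ℓ k i ^ 2 = 1 := by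
  induction ℓ with
  | zero =>
    have h : k = i := Subsingleton.elim (α := Fin 1) k i
    subst h
    rw [Had, Matrix.one_apply_eq, one_pow]
  | succ ℓ ih =>
    simp only [Had, Matrix.reindex_apply, Matrix.submatrix_apply]
    generalize (finSumFinEquiv.trans (finCongr _)).symm k = k'
    generalize (finSumFinEquiv.trans (finCongr _)).symm i = i'
    rcases k' with k' | k' <;> rcases i' with i' | i' <;> simp [ih]

theorem Had_mul_transpose (ℓ : ℕ) : Had ℓ * (Had ℓ).transpose = (2 ^ ℓ : ℝ) • 1 := by
  induction ℓ with
  | zero => simp [Had]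
  | succ ℓ ih =>
    simp only [Had, Matrix.reindex_apply, Matrix.transpose_submatrix]
    rw [Matrix.submatrix_mul_equiv, Matrix.fromBlocks_transpose, Matrix.fromBlocks_multiply]
    have h : (2 ^ ℓ : ℝ) • (1 : Matrix (Fin (2 ^ ℓ)) (Fin (2 ^ ℓ)) ℝ) + (2 ^ ℓ : ℝ) • 1
        = (2 ^ (ℓ + 1) : ℝ) • 1 := by
      rw [← add_smul]; ring_nf
    simp only [Matrix.transpose_neg, Matrix.mul_neg, Matrix.neg_mul, neg_neg, ih, h,
      add_neg_cancel]
    rw [show Matrix.fromBlocks ((2 ^ (ℓ + 1) : ℝ) • (1 : Matrix (Fin (2 ^ ℓ)) (Fin (2 ^ ℓ)) ℝ)) 0 0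
        ((2 ^ (ℓ + 1) : ℝ) • 1) = (2 ^ (ℓ + 1) : ℝ) • 1 by
      rw [← Matrix.fromBlocks_one, Matrix.fromBlocks_smul]; simp,
      Matrix.submatrix_smul, Pi.smul_apply, Pi.smul_apply, Matrix.submatrix_one_equiv]

theorem sum_sq_vecMul_Had (ℓ : ℕ) (s : Fin (2 ^ ℓ) → ℝ) :
    ∑ i, (∑ k, s k * Had ℓ k i) ^ 2 = 2 ^ ℓ * ∑ k, s k ^ 2 := by
  have h : Matrix.vecMul s (Had ℓ) ⬝ᵥ Matrix.vecMul s (Had ℓ) = 2 ^ ℓ * (s ⬝ᵥ s) := by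
    conv_lhs => rw [← Matrix.dotProduct_mulVec, ← Matrix.mulVec_transpose, Matrix.mulVec_mulVec,
      Had_mul_transpose, Matrix.smul_mulVec, Matrix.one_mulVec, dotProduct_smul, smul_eq_mul]
  simpa [dotProduct, Matrix.vecMul, sq] using h

/-- The standard Gaussian law on `ι → ℝ`. -/
abbrev stdGaussianPi (ι : Type*) [Fintype ι] : Measure (ι → ℝ) :=
  Measure.pi fun _ => gaussianReal 0 1

section Gaussian

variable {ι : Type*} [Fintype ι]

theorem integral_cos_add_stdGaussianPi (α : ℝ) (a : ι → ℝ) :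
    ∫ x, cos (α + ∑ i, a i * x i) ∂stdGaussianPi ι = exp (-(∑ i, a i ^ 2) / 2) * cos α := by
  have h : ∫ x, Complex.exp ((α + ∑ i, a i * x i : ℝ) * Complex.I) ∂stdGaussianPi ι
      = Complex.exp (α * Complex.I) * (exp (-(∑ i, a i ^ 2) / 2) : ℝ) := by
    have hprod : ∀ x : ι → ℝ, Complex.exp ((α + ∑ i, a i * x i : ℝ) * Complex.I)
        = Complex.exp (α * Complex.I) * ∏ i, Complex.exp ((a i : ℂ) * (x i : ℂ) * Complex.I) := by
      intro x
      rw [← Complex.exp_sum, ← Complex.exp_add]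
      congr 1
      push_cast
      rw [add_mul, Finset.sum_mul]
    simp_rw [hprod]
    rw [integral_const_mul,
      integral_fintype_prod_eq_prod (f := fun i (y : ℝ) => Complex.exp ((a i : ℂ) * y * Complex.I))]
    congr 1
    have hi : ∀ i, ∫ y : ℝ, Complex.exp ((a i : ℂ) * y * Complex.I) ∂gaussianReal 0 1
        = Complex.exp (-(a i : ℂ) ^ 2 / 2) := by
      intro i
      rw [← charFun_apply_real, charFun_gaussianReal]
      congr 1
      simp
      ring
    simp_rw [hi]
    rw [← Complex.exp_sum]
    push_cast
    congr 1
    rw [← Finset.sum_neg_distrib, Finset.sum_div]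
  have hint : Integrable (fun x : ι → ℝ =>
      Complex.exp ((α + ∑ i, a i * x i : ℝ) * Complex.I)) (stdGaussianPi ι) := by
    refine Integrable.of_bound (C := 1) (Continuous.aestronglyMeasurable (by fun_prop)) ?_
    exact ae_of_all _ fun x => (Complex.norm_exp_ofReal_mul_I _).le
  have h2 := congrArg Complex.re h
  rw [← RCLike.re_eq_complex_re, ← integral_re hint] at h2
  simp only [RCLike.re_eq_complex_re, Complex.exp_ofReal_mul_I_re] at h2
  rw [h2, Complex.re_mul_ofReal, Complex.exp_ofReal_mul_I_re, mul_comm]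

theorem lintegral_exp_stdGaussianPi (a : ι → ℝ) :
    ∫⁻ x, ENNReal.ofReal (exp (∑ i, a i * x i)) ∂stdGaussianPi ι
      = ENNReal.ofReal (exp ((∑ i, a i ^ 2) / 2)) := by
  have hint : Integrable (fun x : ι → ℝ => ∏ i, exp (a i * x i)) (stdGaussianPi ι) :=
    Integrable.fintype_prod (f := fun i (y : ℝ) => exp (a i * y))
      fun i => integrable_exp_mul_gaussianReal (a i)
  simp_rw [Real.exp_sum]
  rw [← ofReal_integral_eq_lintegral_ofReal hint
    (ae_of_all _ fun x => Finset.prod_nonneg fun i _ => (exp_pos _).le),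
    integral_fintype_prod_eq_prod (f := fun i (y : ℝ) => exp (a i * y))]
  have hi : ∀ i, ∫ y : ℝ, exp (a i * y) ∂gaussianReal 0 1 = exp (a i ^ 2 / 2) := by
    intro i
    have := mgf_gaussianReal (p := gaussianReal 0 1) (X := id) (μ := 0) (v := 1) (by simp) (a i)
    simpa [mgf] using this
  simp_rw [hi]
  rw [← Real.exp_sum, Finset.sum_div]

/-- Rotation of each coordinate pair `(x i, y i)` by its own angle `φ i`. -/
def coordRotation (φ : ι → ℝ) (p : (ι → ℝ) × (ι → ℝ)) : (ι → ℝ) × (ι → ℝ) :=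
  (fun i => cos (φ i) * p.1 i + sin (φ i) * p.2 i,
    fun i => -sin (φ i) * p.1 i + cos (φ i) * p.2 i)

theorem measurePreserving_coordRotation (φ : ι → ℝ) :
    MeasurePreserving (coordRotation φ) ((stdGaussianPi ι).prod (stdGaussianPi ι))
      ((stdGaussianPi ι).prod (stdGaussianPi ι)) := by
  have h1 : ∀ i, MeasurePreserving (ContinuousLinearMap.rotation (E := ℝ) (φ i))
      ((gaussianReal 0 1).prod (gaussianReal 0 1)) ((gaussianReal 0 1).prod (gaussianReal 0 1)) :=
    fun i => ⟨by fun_prop, IsGaussian.map_rotation_eq_self (by simp) (φ i)⟩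
  have h2 := measurePreserving_pi _ _ h1
  have h3 := measurePreserving_arrowProdEquivProdArrow ℝ ℝ ι
    (fun _ => gaussianReal 0 1) (fun _ => gaussianReal 0 1)
  exact (h3.comp h2).comp (h3.symm _)

end Gaussian
theorem ofReal_exp_intervalIntegral_le {f : ℝ → ℝ} (hf : Continuous f) {b : ℝ} (hb : 0 < b) :
    ENNReal.ofReal (exp (∫ θ in (0 : ℝ)..b, f θ))
      ≤ ENNReal.ofReal b⁻¹ * ∫⁻ θ in Set.Ioc 0 b, ENNReal.ofReal (exp (b * f θ)) := by
  have hvol : volume.real (Set.Ioc 0 b) = b := by simp [hb.le]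
  have hexp : Continuous fun θ => exp (b * f θ) := by fun_prop
  have hJ := convexOn_exp.map_set_average_le (μ := volume) (t := Set.Ioc 0 b)
    (f := fun θ => b * f θ) continuous_exp.continuousOn isClosed_univ (by simp [hb])
    (by simp) (by simp) (by fun_prop : Continuous fun θ => b * f θ).integrableOn_Ioc
    hexp.integrableOn_Ioc
  rw [setAverage_eq, setAverage_eq, hvol, integral_const_mul, smul_eq_mul, smul_eq_mul,
    inv_mul_cancel_left₀ hb.ne'] at hJ
  rw [intervalIntegral.integral_of_le hb.le, ← ofReal_integral_eq_lintegral_ofReal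
    hexp.integrableOn_Ioc (ae_of_all _ fun θ => (exp_pos _).le),
    ← ENNReal.ofReal_mul (inv_nonneg.2 hb.le)]
  exact ENNReal.ofReal_le_ofReal hJ

section Gaussian

variable {ι κ : Type*} [Fintype ι] [Fintype κ]

set_option maxHeartbeats 1000000 in
/-- Resampling the coordinates in `S` of a standard Gaussian vector changes a trigonometric sum
by a sub-Gaussian amount: the Maurey–Pisier rotation argument. -/
theorem lintegral_exp_sum_cos_sub_le (S : Set ι) (β : κ → (ι → ℝ) → ℝ)
    (hβ : ∀ k, Continuous (β k))
    (hβS : ∀ k x y, (∀ i ∉ S, x i = y i) → β k x = β k y)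
    (a : κ → ι → ℝ) (ha : ∀ k, ∀ i ∉ S, a k i = 0) (V : ℝ)
    (hV : ∀ s : κ → ℝ, (∀ k, |s k| ≤ 1) → ∑ i, (∑ k, s k * a k i) ^ 2 ≤ V) (t : ℝ) :
    ∫⁻ p, ENNReal.ofReal (exp (t * (∑ k, cos (β k p.1 + ∑ i, a k i * p.1 i)
        - ∑ k, cos (β k p.1 + ∑ i, a k i * p.2 i))))
        ∂(stdGaussianPi ι).prod (stdGaussianPi ι)
      ≤ ENNReal.ofReal (exp (t ^ 2 * π ^ 2 / 4 * V / 2)) := by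
  let μ := (stdGaussianPi ι).prod (stdGaussianPi ι)
  let φ : ℝ → ι → ℝ := fun θ i => if i ∈ S then θ else 0
  let u : (ι → ℝ) × (ι → ℝ) → ℝ := fun q =>
    ∑ k, sin (β k q.1 + ∑ i, a k i * q.1 i) * ∑ i, a k i * q.2 i
  have hu : Continuous u := by fun_prop
  have hφ : ∀ i, Continuous fun θ => φ θ i := by
    intro i
    by_cases hi : i ∈ S
    · simpa [φ, hi] using continuous_id'
    · simpa [φ, hi] using continuous_const
  have hrot : Continuous fun z : ((ι → ℝ) × (ι → ℝ)) × ℝ => coordRotation (φ z.2) z.1 := by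
    have h' : ∀ i, Continuous fun z : ((ι → ℝ) × (ι → ℝ)) × ℝ => φ z.2 i :=
      fun i => (hφ i).comp continuous_snd
    unfold coordRotation
    fun_prop
  have hl1 : ∀ θ p k, ∑ i, a k i * (coordRotation (φ θ) p).1 i
      = cos θ * ∑ i, a k i * p.1 i + sin θ * ∑ i, a k i * p.2 i := by
    intro θ p k
    rw [Finset.mul_sum, Finset.mul_sum, ← Finset.sum_add_distrib]
    refine Finset.sum_congr rfl fun i _ => ?_
    by_cases hi : i ∈ S
    · simp only [coordRotation, φ, hi, if_true]; ring
    · simp [ha k i hi]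
  have hl2 : ∀ θ p k, ∑ i, a k i * (coordRotation (φ θ) p).2 i
      = -sin θ * ∑ i, a k i * p.1 i + cos θ * ∑ i, a k i * p.2 i := by
    intro θ p k
    rw [Finset.mul_sum, Finset.mul_sum, ← Finset.sum_add_distrib]
    refine Finset.sum_congr rfl fun i _ => ?_
    by_cases hi : i ∈ S
    · simp only [coordRotation, φ, hi, if_true]; ring
    · simp [ha k i hi]
  have hb : ∀ θ p k, β k (coordRotation (φ θ) p).1 = β k p.1 := by
    intro θ p k
    refine hβS k _ _ fun i hi => ?_
    simp [coordRotation, φ, hi]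
  have hFTC : ∀ p, ∫ θ in (0 : ℝ)..(π / 2), t * u (coordRotation (φ θ) p)
      = t * (∑ k, cos (β k p.1 + ∑ i, a k i * p.1 i)
        - ∑ k, cos (β k p.1 + ∑ i, a k i * p.2 i)) := by
    intro p
    have hd : ∀ θ : ℝ, HasDerivAt (fun θ => -(t * ∑ k, cos (β k p.1
        + (cos θ * ∑ i, a k i * p.1 i + sin θ * ∑ i, a k i * p.2 i))))
        (t * u (coordRotation (φ θ) p)) θ := by
      intro θ
      have hk : ∀ k ∈ (Finset.univ : Finset κ), HasDerivAt (fun θ => cos (β k p.1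
          + (cos θ * ∑ i, a k i * p.1 i + sin θ * ∑ i, a k i * p.2 i)))
          (-sin (β k p.1 + (cos θ * ∑ i, a k i * p.1 i + sin θ * ∑ i, a k i * p.2 i))
            * (-sin θ * ∑ i, a k i * p.1 i + cos θ * ∑ i, a k i * p.2 i)) θ := fun k _ =>
        (((((hasDerivAt_cos θ).mul_const _).add ((hasDerivAt_sin θ).mul_const _)).const_add _).cos)
      refine ((HasDerivAt.fun_sum hk).const_mul t).fun_neg.congr_deriv ?_
      simp only [u, hl1, hl2, hb, neg_mul, Finset.sum_neg_distrib, mul_neg, neg_neg]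
    rw [intervalIntegral.integral_eq_sub_of_hasDerivAt (fun θ _ => hd θ)]
    · simp
      ring
    · refine Continuous.intervalIntegrable ?_ _ _
      have : Continuous fun θ => coordRotation (φ θ) p :=
        hrot.comp (by fun_prop : Continuous fun θ : ℝ => (p, θ))
      fun_prop
  have hinner : ∀ θ, ∫⁻ p, ENNReal.ofReal (exp (π / 2 * (t * u (coordRotation (φ θ) p)))) ∂μ
      ≤ ENNReal.ofReal (exp (t ^ 2 * π ^ 2 / 4 * V / 2)) := by
    intro θ
    have hm : Measurable fun q => ENNReal.ofReal (exp (π / 2 * (t * u q))) :=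
      (by fun_prop : Continuous fun q => exp (π / 2 * (t * u q))).measurable.ennreal_ofReal
    rw [(measurePreserving_coordRotation (φ θ)).lintegral_comp hm,
      lintegral_prod _ hm.aemeasurable]
    calc _ ≤ ∫⁻ x, ENNReal.ofReal (exp (t ^ 2 * π ^ 2 / 4 * V / 2)) ∂stdGaussianPi ι := by
          refine lintegral_mono fun x => ?_
          let s : κ → ℝ := fun k => sin (β k x + ∑ i, a k i * x i)
          have hlin : ∀ y : ι → ℝ, π / 2 * (t * u (x, y))
              = ∑ i, (π / 2 * t * ∑ k, s k * a k i) * y i := by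
            intro y
            simp only [u, Finset.mul_sum, Finset.sum_mul]
            rw [Finset.sum_comm]
            refine Finset.sum_congr rfl fun i _ => Finset.sum_congr rfl fun k _ => ?_
            simp only [s]
            ring
          simp only [hlin]
          rw [lintegral_exp_stdGaussianPi]
          refine ENNReal.ofReal_le_ofReal (exp_le_exp.2 ?_)
          simp only [mul_pow _ (∑ k, _)]
          rw [← Finset.mul_sum]
          have := hV s fun k => abs_sin_le_one _
          have h0 : 0 ≤ (π / 2 * t) ^ 2 := sq_nonneg _
          nlinarith [mul_le_mul_of_nonneg_left this h0]
      _ = _ := by simp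
  calc _ ≤ ∫⁻ p, (ENNReal.ofReal (π / 2)⁻¹ * ∫⁻ θ in Set.Ioc 0 (π / 2),
        ENNReal.ofReal (exp (π / 2 * (t * u (coordRotation (φ θ) p))))) ∂μ := by
        refine lintegral_mono fun p => ?_
        rw [← hFTC]
        refine ofReal_exp_intervalIntegral_le ?_ (by positivity)
        have : Continuous fun θ => coordRotation (φ θ) p :=
          hrot.comp (by fun_prop : Continuous fun θ : ℝ => (p, θ))
        fun_prop
    _ = ENNReal.ofReal (π / 2)⁻¹ * ∫⁻ θ in Set.Ioc 0 (π / 2), ∫⁻ p,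
        ENNReal.ofReal (exp (π / 2 * (t * u (coordRotation (φ θ) p)))) ∂μ := by
        rw [lintegral_const_mul' _ _ ENNReal.ofReal_ne_top, lintegral_lintegral_swap]
        refine Measurable.aemeasurable ?_
        exact (by fun_prop : Continuous fun z : ((ι → ℝ) × (ι → ℝ)) × ℝ =>
          exp (π / 2 * (t * u (coordRotation (φ z.2) z.1)))).measurable.ennreal_ofReal
    _ ≤ ENNReal.ofReal (π / 2)⁻¹ * ∫⁻ θ in Set.Ioc 0 (π / 2),
        ENNReal.ofReal (exp (t ^ 2 * π ^ 2 / 4 * V / 2)) := by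
        gcongr with θ
        exact hinner θ
    _ = _ := by
        rw [setLIntegral_const, Real.volume_Ioc, sub_zero, mul_left_comm,
          ← ENNReal.ofReal_mul (by positivity), inv_mul_cancel₀ (by positivity)]
        simp

end Gaussian
section Pi

variable {Ω : Type*} [MeasurableSpace Ω] {ν : Measure Ω} [IsProbabilityMeasure ν]

theorem measure_pi_abs_average_gt_le {m : ℕ} (hm : 0 < m) {f : Fin m → Ω → ℝ} {c : ℝ≥0}
    (hf : ∀ j, HasSubgaussianMGF (f j) c ν) {t : ℝ} (ht : 0 ≤ t) :
    Measure.pi (fun _ : Fin m => ν) {x | t < |(m : ℝ)⁻¹ * ∑ j, f j (x j)|}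
      ≤ ENNReal.ofReal (2 * exp (-(m * t ^ 2 / (2 * c)))) := by
  have hm' : (0 : ℝ) < m := by exact_mod_cast hm
  have tail : ∀ g : Fin m → Ω → ℝ, (∀ j, HasSubgaussianMGF (g j) c ν) →
      Measure.pi (fun _ : Fin m => ν) {x | m * t ≤ ∑ j, g j (x j)}
        ≤ ENNReal.ofReal (exp (-(m * t ^ 2 / (2 * c)))) := by
    intro g hg
    have hind : iIndepFun (fun j (x : Fin m → Ω) => g j (x j)) (Measure.pi fun _ => ν) :=
      iIndepFun_pi fun j => (hg j).aemeasurable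
    have hsub : ∀ j ∈ (Finset.univ : Finset (Fin m)),
        HasSubgaussianMGF (fun x : Fin m → Ω => g j (x j)) c (Measure.pi fun _ => ν) := by
      intro j _
      refine HasSubgaussianMGF.of_map (Y := fun x : Fin m → Ω => x j) (X := g j)
        (measurable_pi_apply j).aemeasurable ?_
      rw [(measurePreserving_eval (fun _ : Fin m => ν) j).map_eq]
      exact hg j
    have h := HasSubgaussianMGF.measure_sum_ge_le_of_iIndepFun hind (c := fun _ => c) hsub
      (ε := m * t) (by positivity)
    rw [Measure.real, ← ENNReal.le_ofReal_iff_toReal_le (measure_ne_top _ _) (exp_pos _).le] at h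
    refine h.trans (ENNReal.ofReal_le_ofReal (exp_le_exp.2 (le_of_eq ?_)))
    simp only [Finset.sum_const, Finset.card_univ, Fintype.card_fin, nsmul_eq_mul,
      NNReal.coe_mul, NNReal.coe_natCast]
    field_simp
  have hsubset : {x : Fin m → Ω | t < |(m : ℝ)⁻¹ * ∑ j, f j (x j)|}
      ⊆ {x | m * t ≤ ∑ j, f j (x j)} ∪ {x | m * t ≤ ∑ j, (-f j) (x j)} := by
    intro x hx
    simp only [Set.mem_ofPred_eq, Set.mem_union, Pi.neg_apply, Finset.sum_neg_distrib] at hx ⊢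
    rw [abs_mul, abs_of_pos (inv_pos.2 hm'), inv_mul_eq_div, lt_div_iff₀ hm'] at hx
    rcases lt_abs.1 hx with h | h
    · left; linarith
    · right; linarith
  refine (measure_mono hsubset).trans ((measure_union_le _ _).trans ?_)
  rw [two_mul, ENNReal.ofReal_add (exp_pos _).le (exp_pos _).le]
  exact add_le_add (tail f hf) (tail (fun j => -f j) fun j => (hf j).neg)

end Pi

theorem lintegral_exp_integral_le {X Y : Type*} [TopologicalSpace X] [MeasurableSpace X]
    [BorelSpace X] [SecondCountableTopology X] [TopologicalSpace Y] [MeasurableSpace Y]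
    [BorelSpace Y] [SecondCountableTopology Y] {μ : Measure X} {ν : Measure Y}
    [IsProbabilityMeasure ν] {F : X → Y → ℝ} (hF : Continuous (Function.uncurry F)) {B : ℝ}
    (hB : ∀ x y, |F x y| ≤ B) :
    ∫⁻ x, ENNReal.ofReal (exp (∫ y, F x y ∂ν)) ∂μ
      ≤ ∫⁻ p, ENNReal.ofReal (exp (F p.1 p.2)) ∂μ.prod ν := by
  have hm : Measurable fun p : X × Y => ENNReal.ofReal (exp (F p.1 p.2)) :=
    (continuous_exp.comp hF).measurable.ennreal_ofReal
  rw [lintegral_prod _ hm.aemeasurable]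
  refine lintegral_mono fun x => ?_
  have hFx : Continuous (F x) := hF.uncurry_left x
  have h1 : Integrable (F x) ν :=
    Integrable.of_bound (C := B) hFx.measurable.aestronglyMeasurable (ae_of_all _ fun y => hB x y)
  have h2 : Integrable (fun y => exp (F x y)) ν := by
    refine Integrable.of_bound (C := exp B)
      (continuous_exp.comp hFx).measurable.aestronglyMeasurable (ae_of_all _ fun y => ?_)
    rw [Real.norm_of_nonneg (exp_pos _).le, exp_le_exp]
    exact le_of_abs_le (hB x y)
  rw [← ofReal_integral_eq_lintegral_ofReal h2 (ae_of_all _ fun y => (exp_pos _).le)]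
  exact ENNReal.ofReal_le_ofReal (convexOn_exp.map_integral_le continuous_exp.continuousOn
    isClosed_univ (by simp) h1 h2)

/-- The `k`-th entry of `H_d diag(g) v`. -/
def hadDot (ℓ : ℕ) (v g : Fin (2 ^ ℓ) → ℝ) (k : Fin (2 ^ ℓ)) : ℝ :=
  ∑ i, Had ℓ k i * v i * g i

/-- The average of the cosines of the entries of `H_d diag(g) v`, shifted by the phases `θ`. -/
def trigAvg (ℓ : ℕ) (θ v g : Fin (2 ^ ℓ) → ℝ) : ℝ :=
  (2 ^ ℓ : ℝ)⁻¹ * ∑ k, cos (θ k + hadDot ℓ v g k)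

theorem hadDot_add (ℓ : ℕ) (v w g : Fin (2 ^ ℓ) → ℝ) (k : Fin (2 ^ ℓ)) :
    hadDot ℓ (v + w) g k = hadDot ℓ v g k + hadDot ℓ w g k := by
  simp only [hadDot, ← Finset.sum_add_distrib, Pi.add_apply]
  exact Finset.sum_congr rfl fun i _ => by ring

theorem abs_trigAvg_le_one (ℓ : ℕ) (θ v g : Fin (2 ^ ℓ) → ℝ) : |trigAvg ℓ θ v g| ≤ 1 := by
  have h : |∑ k, cos (θ k + hadDot ℓ v g k)| ≤ 2 ^ ℓ := by
    refine (Finset.abs_sum_le_sum_abs _ _).trans ?_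
    refine (Finset.sum_le_sum fun k _ => abs_cos_le_one _).trans ?_
    simp
  rw [trigAvg, abs_mul, abs_of_pos (by positivity), inv_mul_eq_div]
  exact (div_le_one (by positivity)).2 h

theorem continuous_trigAvg (ℓ : ℕ) (θ v : Fin (2 ^ ℓ) → ℝ) : Continuous (trigAvg ℓ θ v) := by
  unfold trigAvg hadDot
  fun_prop

/-- Adding to `v` a vector `w` of disjoint support multiplies the trigonometric average by
`exp (-‖w‖² / 2)`, up to a sub-Gaussian fluctuation governed by the sup norm of `w`. -/
theorem hasSubgaussianMGF_trigAvg_add (ℓ : ℕ) (θ v w : Fin (2 ^ ℓ) → ℝ)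
    (hdisj : ∀ i, w i ≠ 0 → v i = 0) {M : ℝ} (hM : ∀ i, |w i| ≤ M) :
    HasSubgaussianMGF
      (fun g => trigAvg ℓ θ (v + w) g - exp (-(∑ i, w i ^ 2) / 2) * trigAvg ℓ θ v g)
      (Real.toNNReal (π ^ 2 / 4 * M ^ 2)) (stdGaussianPi (Fin (2 ^ ℓ))) := by
  set ν := stdGaussianPi (Fin (2 ^ ℓ))
  have hcont : Continuous fun g =>
      trigAvg ℓ θ (v + w) g - exp (-(∑ i, w i ^ 2) / 2) * trigAvg ℓ θ v g :=
    (continuous_trigAvg _ _ _).sub (continuous_const.mul (continuous_trigAvg _ _ _))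
  have hint : ∀ t : ℝ, Integrable (fun g => exp (t *
      (trigAvg ℓ θ (v + w) g - exp (-(∑ i, w i ^ 2) / 2) * trigAvg ℓ θ v g))) ν := by
    intro t
    refine Integrable.of_bound (C := exp (|t| * 2))
      (Continuous.aestronglyMeasurable (by fun_prop)) (ae_of_all _ fun g => ?_)
    rw [Real.norm_of_nonneg (exp_pos _).le, exp_le_exp]
    refine (le_abs_self _).trans ?_
    rw [abs_mul]
    gcongr
    refine (abs_sub _ _).trans ?_
    have h1 : exp (-(∑ i, w i ^ 2) / 2) ≤ 1 :=
      exp_le_one_iff.2 (by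
        have : 0 ≤ ∑ i, w i ^ 2 := Finset.sum_nonneg fun i _ => sq_nonneg _
        linarith)
    rw [abs_mul, abs_of_pos (exp_pos _)]
    have := mul_le_one₀ h1 (abs_nonneg _) (abs_trigAvg_le_one ℓ θ v g)
    linarith [abs_trigAvg_le_one ℓ θ (v + w) g]
  refine ⟨hint, fun t => ?_⟩
  let β : Fin (2 ^ ℓ) → (Fin (2 ^ ℓ) → ℝ) → ℝ := fun k x => θ k + hadDot ℓ v x k
  let a : Fin (2 ^ ℓ) → Fin (2 ^ ℓ) → ℝ := fun k i => Had ℓ k i * w i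
  have hβ : ∀ k, Continuous (β k) := by
    intro k
    simp only [β, hadDot]
    fun_prop
  have hpis := lintegral_exp_sum_cos_sub_le {i | w i ≠ 0} β hβ
    (by
      intro k x y hxy
      simp only [β, hadDot]
      congr 1
      refine Finset.sum_congr rfl fun i _ => ?_
      by_cases hi : w i = 0
      · rw [hxy i (by simpa using hi)]
      · simp [hdisj i hi])
    a (by
      intro k i hi
      have : w i = 0 := by simpa using hi
      simp [a, this]) ((2 ^ ℓ) ^ 2 * M ^ 2)
    (by
      intro s hs
      have hs2 : ∑ k, s k ^ 2 ≤ 2 ^ ℓ := by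
        refine (Finset.sum_le_sum fun k _ => (sq_le_one_iff_abs_le_one _).2 (hs k)).trans ?_
        simp
      calc ∑ i, (∑ k, s k * a k i) ^ 2
          = ∑ i, w i ^ 2 * (∑ k, s k * Had ℓ k i) ^ 2 := by
            refine Finset.sum_congr rfl fun i _ => ?_
            rw [← mul_pow, Finset.mul_sum]
            congr 1
            refine Finset.sum_congr rfl fun k _ => ?_
            simp only [a]; ring
        _ ≤ ∑ i, M ^ 2 * (∑ k, s k * Had ℓ k i) ^ 2 := by
            refine Finset.sum_le_sum fun i _ => ?_
            gcongr 1
            exact sq_le_sq' (neg_le_of_abs_le (hM i)) (le_of_abs_le (hM i))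
        _ = M ^ 2 * (2 ^ ℓ * ∑ k, s k ^ 2) := by
            rw [← Finset.mul_sum, sum_sq_vecMul_Had]
        _ ≤ M ^ 2 * (2 ^ ℓ * 2 ^ ℓ) := by gcongr
        _ = _ := by ring)
    (t * (2 ^ ℓ)⁻¹)
  let F : (Fin (2 ^ ℓ) → ℝ) → (Fin (2 ^ ℓ) → ℝ) → ℝ := fun x y =>
    t * (2 ^ ℓ)⁻¹ * (∑ k, cos (β k x + ∑ i, a k i * x i) - ∑ k, cos (β k x + ∑ i, a k i * y i))
  have hF : Continuous (Function.uncurry F) := by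
    have : ∀ k, Continuous fun p : (Fin (2 ^ ℓ) → ℝ) × (Fin (2 ^ ℓ) → ℝ) => β k p.1 :=
      fun k => (hβ k).comp continuous_fst
    simp only [F, Function.uncurry_def]
    fun_prop
  have hcosint : ∀ x k, Integrable (fun y : Fin (2 ^ ℓ) → ℝ => cos (β k x + ∑ i, a k i * y i)) ν :=
    fun x k => Integrable.of_bound (C := 1) (Continuous.aestronglyMeasurable (by fun_prop))
      (ae_of_all _ fun y => abs_cos_le_one _)
  have hFint : ∀ x, ∫ y, F x y ∂ν = t *
      (trigAvg ℓ θ (v + w) x - exp (-(∑ i, w i ^ 2) / 2) * trigAvg ℓ θ v x) := by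
    intro x
    have hk : ∀ k, ∫ y, cos (β k x + ∑ i, a k i * y i) ∂ν
        = exp (-(∑ i, w i ^ 2) / 2) * cos (β k x) := by
      intro k
      rw [integral_cos_add_stdGaussianPi]
      simp only [a, mul_pow, Had_sq, one_mul]
    simp only [F]
    rw [integral_const_mul, integral_sub (integrable_const _)
      (integrable_finsetSum _ fun k _ => hcosint x k), integral_finsetSum _ fun k _ => hcosint x k]
    simp only [hk, integral_const, probReal_univ, one_smul, trigAvg, hadDot_add, ← Finset.mul_sum]
    simp only [β, a, hadDot, add_assoc]
    ring
  have hFb : ∀ x y, |F x y| ≤ |t| * 2 := by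
    intro x y
    have h : ∀ z : Fin (2 ^ ℓ) → ℝ, |∑ k, cos (β k x + ∑ i, a k i * z i)| ≤ 2 ^ ℓ := by
      intro z
      refine (Finset.abs_sum_le_sum_abs _ _).trans ?_
      refine (Finset.sum_le_sum fun k _ => abs_cos_le_one _).trans ?_
      simp
    simp only [F]
    rw [abs_mul, abs_mul, abs_of_pos (by positivity : (0 : ℝ) < (2 ^ ℓ)⁻¹), mul_assoc]
    gcongr
    rw [inv_mul_eq_div, div_le_iff₀ (by positivity)]
    exact (abs_sub _ _).trans (by linarith [h x, h y])
  rw [← ENNReal.ofReal_le_ofReal_iff (exp_pos _).le, mgf,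
    ofReal_integral_eq_lintegral_ofReal (hint t) (ae_of_all _ fun y => (exp_pos _).le)]
  simp only [← hFint]
  refine (lintegral_exp_integral_le hF hFb).trans (hpis.trans
    (ENNReal.ofReal_le_ofReal (exp_le_exp.2 (le_of_eq ?_))))
  rw [Real.coe_toNNReal _ (by positivity)]
  field_simp
/-- The average over all blocks of the cosines of the randomized Hadamard transform of `v`,
shifted by the phases `θ`. -/
def featAvg (ℓ m : ℕ) (θ D : Fin m → Fin (2 ^ ℓ) → ℝ) (v : Fin (2 ^ ℓ) → ℝ) : ℝ :=
  (m : ℝ)⁻¹ * ∑ j, trigAvg ℓ (θ j) v (D j)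

theorem diagMeasure_featAvg_add_le (ℓ : ℕ) {m : ℕ} (hm : 0 < m) (θ : Fin m → Fin (2 ^ ℓ) → ℝ)
    (v w : Fin (2 ^ ℓ) → ℝ) (hdisj : ∀ i, w i ≠ 0 → v i = 0) {M : ℝ} (hM0 : 0 < M)
    (hM : ∀ i, |w i| ≤ M) {t : ℝ} (ht : 0 ≤ t) :
    diagMeasure ℓ m {D | t < |featAvg ℓ m θ D (v + w)
        - exp (-(∑ i, w i ^ 2) / 2) * featAvg ℓ m θ D v|}
      ≤ ENNReal.ofReal (2 * exp (-(m * t ^ 2 / (5 * M ^ 2)))) := by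
  have h := measure_pi_abs_average_gt_le hm
    (fun j => hasSubgaussianMGF_trigAvg_add ℓ (θ j) v w hdisj hM) ht
  have hset : {D : Fin m → Fin (2 ^ ℓ) → ℝ | t < |featAvg ℓ m θ D (v + w)
        - exp (-(∑ i, w i ^ 2) / 2) * featAvg ℓ m θ D v|}
      = {D | t < |(m : ℝ)⁻¹ * ∑ j, (trigAvg ℓ (θ j) (v + w) (D j)
        - exp (-(∑ i, w i ^ 2) / 2) * trigAvg ℓ (θ j) v (D j))|} := by
    ext D
    simp only [Set.mem_ofPred_eq, featAvg, Finset.sum_sub_distrib, ← Finset.mul_sum]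
    ring_nf
  rw [hset]
  refine h.trans (ENNReal.ofReal_le_ofReal ?_)
  rw [Real.coe_toNNReal _ (by positivity)]
  have hπ : π ^ 2 ≤ 10 := by nlinarith [pi_lt_d2, pi_pos]
  have hM2 : 2 * (π ^ 2 / 4 * M ^ 2) ≤ 5 * M ^ 2 := by nlinarith [sq_nonneg M]
  exact mul_le_mul_of_nonneg_left (exp_le_exp.2 (neg_le_neg
    (div_le_div_of_nonneg_left (by positivity) (by positivity) hM2))) zero_le_two

/-- The coordinates of `v` exceeding `τ` in absolute value, the others being set to `0`. -/
def hiPart {ι : Type*} (τ : ℝ) (v : ι → ℝ) (i : ι) : ℝ := if τ < |v i| then v i else 0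

section HiPart

variable {ι : Type*}

theorem sub_hiPart_ne_zero {τ : ℝ} {v : ι → ℝ} {i : ι} (h : (v - hiPart τ v) i ≠ 0) :
    hiPart τ v i = 0 := by
  simp only [Pi.sub_apply, hiPart] at h ⊢
  split_ifs at h ⊢ <;> simp_all

theorem abs_sub_hiPart_le {τ : ℝ} (hτ : 0 ≤ τ) (v : ι → ℝ) (i : ι) :
    |(v - hiPart τ v) i| ≤ τ := by
  simp only [Pi.sub_apply, hiPart]
  split_ifs with h
  · simpa using hτ
  · simpa using h

theorem hiPart_hiPart {τ σ : ℝ} (h : σ ≤ τ) (v : ι → ℝ) :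
    hiPart τ (hiPart σ v) = hiPart τ v := by
  funext i
  simp only [hiPart]
  by_cases h1 : σ < |v i|
  · simp [h1]
  · have h2 : ¬ τ < |v i| := fun h2 => h1 (h.trans_lt h2)
    simp [h1, h2]

theorem sum_sq_sub_hiPart [Fintype ι] (τ : ℝ) (v : ι → ℝ) :
    ∑ i, (v - hiPart τ v) i ^ 2 = ∑ i, v i ^ 2 - ∑ i, hiPart τ v i ^ 2 := by
  rw [← Finset.sum_sub_distrib]
  refine Finset.sum_congr rfl fun i _ => ?_
  simp only [Pi.sub_apply, hiPart]
  split_ifs <;> ring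

theorem card_support_hiPart_le [Fintype ι] {R : ℝ} (hR : 0 < R) (l : ℕ) (v : ι → ℝ)
    (hv : ∑ i, v i ^ 2 ≤ R ^ 2) :
    (Finset.univ.filter fun i => hiPart (R / 2 ^ l) v i ≠ 0).card ≤ 4 ^ l := by
  set s := Finset.univ.filter fun i => hiPart (R / 2 ^ l) v i ≠ 0
  have h1 : (s.card : ℝ) * (R / 2 ^ l) ^ 2 ≤ R ^ 2 := by
    calc (s.card : ℝ) * (R / 2 ^ l) ^ 2 = ∑ i ∈ s, (R / 2 ^ l) ^ 2 := by simp
      _ ≤ ∑ i ∈ s, v i ^ 2 := by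
        refine Finset.sum_le_sum fun i hi => ?_
        have hi' : hiPart (R / 2 ^ l) v i ≠ 0 := (Finset.mem_filter.1 hi).2
        simp only [hiPart] at hi'
        split_ifs at hi' with h
        · rw [← sq_abs (v i)]
          gcongr
        · exact absurd rfl hi'
      _ ≤ ∑ i, v i ^ 2 := Finset.sum_le_univ_sum_of_nonneg fun i => sq_nonneg _
      _ ≤ R ^ 2 := hv
  have h2 : (s.card : ℝ) ≤ 4 ^ l := by
    have h4 : ((2 : ℝ) ^ l) ^ 2 = 4 ^ l := by rw [← pow_mul, mul_comm, pow_mul]; norm_num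
    rw [div_pow, h4, mul_div_assoc', div_le_iff₀ (by positivity), mul_comm] at h1
    exact le_of_mul_le_mul_left h1 (by positivity)
  exact_mod_cast h2

/-- Vectors with entries in a finite set and few nonzero coordinates are few. -/
theorem exists_finset_sparse [Fintype ι] [Nonempty ι] (A : Finset ℝ) (h0 : (0 : ℝ) ∈ A) (s : ℕ) :
    ∃ T : Finset (ι → ℝ), T.card ≤ (Fintype.card ι * A.card) ^ s ∧
      ∀ v : ι → ℝ, (∀ i, v i ∈ A) → (Finset.univ.filter fun i => v i ≠ 0).card ≤ s → v ∈ T := by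
  induction s with
  | zero =>
    refine ⟨{0}, by simp, fun v _ hv => ?_⟩
    simp only [nonpos_iff_eq_zero, Finset.card_eq_zero, Finset.filter_eq_empty_iff] at hv
    simp only [Finset.mem_singleton]
    funext i
    simpa using hv (Finset.mem_univ i)
  | succ s ih =>
    obtain ⟨T, hT, hmem⟩ := ih
    refine ⟨Finset.image (fun q : (ι × ℝ) × (ι → ℝ) => Function.update q.2 q.1.1 q.1.2)
      ((Finset.univ ×ˢ A) ×ˢ T), ?_, fun v hvA hv => ?_⟩
    · refine Finset.card_image_le.trans ?_
      rw [Finset.card_product, Finset.card_product, Finset.card_univ, pow_succ, mul_comm]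
      exact Nat.mul_le_mul_right _ hT
    · rw [Finset.mem_image]
      by_cases hz : ∃ i, v i ≠ 0
      · obtain ⟨i, hi⟩ := hz
        refine ⟨((i, v i), Function.update v i 0), ?_, by simp⟩
        simp only [Finset.mem_product, Finset.mem_univ, true_and]
        refine ⟨hvA i, hmem _ (fun j => ?_) ?_⟩
        · by_cases hj : j = i
          · subst hj; simpa using h0
          · simpa [hj] using hvA j
        · have hsub : (Finset.univ.filter fun j => Function.update v i 0 j ≠ 0)
              ⊆ (Finset.univ.filter fun j => v j ≠ 0).erase i := by
            intro j hj
            by_cases hji : j = i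
            · subst hji; simp at hj
            · simpa [hji] using hj
          refine (Finset.card_le_card hsub).trans ?_
          rw [Finset.card_erase_of_mem (by simpa using hi)]
          omega
      · push Not at hz
        have hv0 : v = 0 := funext hz
        refine ⟨((Classical.arbitrary ι, 0), 0), ?_, by simp [hv0]⟩
        simp only [Finset.mem_product, Finset.mem_univ, true_and]
        exact ⟨h0, hmem 0 (by simpa using h0) (by simp)⟩

/-- If passing from the large coordinates to one dyadic scale further multiplies `G` by the
expected Gaussian factor up to an error `t`, then `G v` is close to `exp (-‖v‖² / 2) * G 0`. -/
theorem abs_sub_exp_mul_le_of_dyadic [Fintype ι] (G : (ι → ℝ) → ℝ) {R t : ℝ} (hR : 0 < R)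
    (v : ι → ℝ) (hvR : ∀ i, |v i| ≤ R) (L : ℕ) (V : ℕ → ι → ℝ)
    (hV : ∀ l ≤ L, V l = hiPart (R / 2 ^ l) v) (hVL : V (L + 1) = v)
    (hstep : ∀ l ≤ L, |G (V (l + 1)) - exp (-(∑ i, (V (l + 1) - hiPart (R / 2 ^ l) (V (l + 1))) i ^ 2)
      / 2) * G (hiPart (R / 2 ^ l) (V (l + 1)))| ≤ t) :
    |G v - exp (-(∑ i, v i ^ 2) / 2) * G 0| ≤ (L + 1) * t := by
  have hV0 : V 0 = 0 := by
    rw [hV 0 (Nat.zero_le _)]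
    funext i
    simp [hiPart, (hvR i)]
  have hhi : ∀ l ≤ L, hiPart (R / 2 ^ l) (V (l + 1)) = V l := by
    intro l hl
    rcases hl.lt_or_eq with h | h
    · rw [hV (l + 1) h, hV l hl, hiPart_hiPart]
      gcongr
      · norm_num
      · omega
    · subst h
      rw [hVL, hV l le_rfl]
  have key : ∀ l ≤ L + 1, |G (V l) - exp (-(∑ i, V l i ^ 2) / 2) * G 0| ≤ l * t := by
    intro l
    induction l with
    | zero => simp [hV0]
    | succ l ih =>
      intro hl
      have h1 := ih (by omega)
      have h2 := hstep l (by omega)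
      have h3 := sum_sq_sub_hiPart (R / 2 ^ l) (V (l + 1))
      set q := ∑ i, (V (l + 1) - hiPart (R / 2 ^ l) (V (l + 1))) i ^ 2
      have hq : 0 ≤ q := Finset.sum_nonneg fun i _ => sq_nonneg _
      rw [hhi l (by omega)] at h2 h3
      have he : exp (-(∑ i, V (l + 1) i ^ 2) / 2)
          = exp (-q / 2) * exp (-(∑ i, V l i ^ 2) / 2) := by
        rw [← exp_add, h3]; congr 1; ring
      have he1 : exp (-q / 2) ≤ 1 := exp_le_one_iff.2 (by linarith)
      rw [he]
      calc _ = |(G (V (l + 1)) - exp (-q / 2) * G (V l))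
            + exp (-q / 2) * (G (V l) - exp (-(∑ i, V l i ^ 2) / 2) * G 0)| := by
            congr 1; ring
        _ ≤ t + l * t := by
            refine (abs_add_le _ _).trans (add_le_add h2 ?_)
            rw [abs_mul, abs_of_pos (exp_pos _)]
            exact (mul_le_of_le_one_left (abs_nonneg _) he1).trans h1
        _ = _ := by push_cast; ring
  have := key (L + 1) le_rfl
  rw [hVL] at this
  exact_mod_cast this

end HiPart

theorem diagMeasure_exists_grid_le (ℓ : ℕ) {m : ℕ} (hm : 0 < m) (θ : Fin m → Fin (2 ^ ℓ) → ℝ)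
    (A : Finset ℝ) (h0 : (0 : ℝ) ∈ A) {R t δ : ℝ} (hR : 0 < R) (ht : 0 ≤ t) (hδ : 0 < δ)
    (hδ1 : δ ≤ 1)
    (hmt : 4 * log (2 ^ ℓ * A.card) + log (2 * (ℓ + 1) / δ) ≤ m * t ^ 2 / (5 * R ^ 2)) :
    diagMeasure ℓ m {D | ∃ v : Fin (2 ^ ℓ) → ℝ, (∀ i, v i ∈ A) ∧ ∑ i, v i ^ 2 ≤ R ^ 2 ∧
        (ℓ + 1) * t < |featAvg ℓ m θ D v - exp (-(∑ i, v i ^ 2) / 2) * featAvg ℓ m θ D 0|}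
      ≤ ENNReal.ofReal δ := by
  choose T hTcard hTmem using fun l : ℕ =>
    exists_finset_sparse (ι := Fin (2 ^ ℓ)) A h0 (4 ^ (l + 1))
  let bad : ℕ → (Fin (2 ^ ℓ) → ℝ) → Set (Fin m → Fin (2 ^ ℓ) → ℝ) := fun l u =>
    {D | t < |featAvg ℓ m θ D u - exp (-(∑ i, (u - hiPart (R / 2 ^ l) u) i ^ 2) / 2)
      * featAvg ℓ m θ D (hiPart (R / 2 ^ l) u)|}
  have hsub : {D | ∃ v : Fin (2 ^ ℓ) → ℝ, (∀ i, v i ∈ A) ∧ ∑ i, v i ^ 2 ≤ R ^ 2 ∧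
        (ℓ + 1) * t < |featAvg ℓ m θ D v - exp (-(∑ i, v i ^ 2) / 2) * featAvg ℓ m θ D 0|}
      ⊆ ⋃ l ∈ Finset.range (ℓ + 1), ⋃ u ∈ T l, bad l u := by
    rintro D ⟨v, hvA, hvR, hlt⟩
    by_contra hD
    simp only [Set.mem_iUnion, not_exists, Finset.mem_range, bad, Set.mem_ofPred_eq, not_lt] at hD
    refine absurd hlt (not_lt.2 ?_)
    have hvi : ∀ i, |v i| ≤ R := fun i => abs_le_of_sq_le_sq
      ((Finset.single_le_sum (fun j _ => sq_nonneg (v j)) (Finset.mem_univ i)).trans hvR) hR.le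
    refine abs_sub_exp_mul_le_of_dyadic (featAvg ℓ m θ D) hR v hvi ℓ
      (fun l => if l ≤ ℓ then hiPart (R / 2 ^ l) v else v) (fun l hl => by simp [hl]) (by simp) ?_
    intro l hl
    refine hD l (by omega) _ (hTmem l _ (fun i => ?_) ?_)
    · split_ifs
      · simp only [hiPart]
        split_ifs
        · exact hvA i
        · exact h0
      · exact hvA i
    · split_ifs with h
      · exact card_support_hiPart_le hR _ v hvR
      · refine (Finset.card_le_univ _).trans ?_
        rw [Fintype.card_fin]
        calc 2 ^ ℓ ≤ 4 ^ ℓ := Nat.pow_le_pow_left (by norm_num) _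
          _ ≤ 4 ^ (l + 1) := Nat.pow_le_pow_right (by norm_num) (by omega)
  have hN : 1 ≤ (2 ^ ℓ : ℝ) * A.card := by
    have h1 : (1 : ℝ) ≤ A.card := by exact_mod_cast Finset.card_pos.2 ⟨0, h0⟩
    have h2 : (1 : ℝ) ≤ 2 ^ ℓ := one_le_pow₀ (by norm_num)
    nlinarith
  have hbad : ∀ l u, diagMeasure ℓ m (bad l u)
      ≤ ENNReal.ofReal (2 * exp (-(m * t ^ 2 / (5 * (R / 2 ^ l) ^ 2)))) := by
    intro l u
    have h := diagMeasure_featAvg_add_le ℓ hm θ (hiPart (R / 2 ^ l) u) (u - hiPart (R / 2 ^ l) u)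
      (fun i hi => sub_hiPart_ne_zero hi) (M := R / 2 ^ l) (by positivity)
      (abs_sub_hiPart_le (by positivity) u) ht
    rwa [add_sub_cancel] at h
  set Λ := log (2 ^ ℓ * A.card) with hΛ
  set B := log (2 * (ℓ + 1) / δ) with hB
  have hΛ0 : 0 ≤ Λ := log_nonneg hN
  have hB0 : 0 ≤ B := by
    refine log_nonneg ((one_le_div hδ).2 ?_)
    have : (0 : ℝ) ≤ ℓ := Nat.cast_nonneg _
    linarith
  have hlevel : ∀ l, ∑ u ∈ T l, diagMeasure ℓ m (bad l u) ≤ ENNReal.ofReal (δ / (ℓ + 1)) := by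
    intro l
    refine (Finset.sum_le_card_nsmul _ _ _ fun u _ => hbad l u).trans ?_
    rw [nsmul_eq_mul, ← ENNReal.ofReal_natCast, ← ENNReal.ofReal_mul (Nat.cast_nonneg _)]
    refine ENNReal.ofReal_le_ofReal ?_
    have hc : ((T l).card : ℝ) ≤ exp (4 ^ (l + 1) * Λ) := by
      have h1 : ((T l).card : ℝ) ≤ (2 ^ ℓ * A.card) ^ (4 ^ (l + 1)) := by
        have := hTcard l
        rw [Fintype.card_fin] at this
        exact_mod_cast this
      refine h1.trans (le_of_eq ?_)
      rw [← exp_log (show (0 : ℝ) < 2 ^ ℓ * A.card by linarith), ← exp_nat_mul, ← hΛ]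
      push_cast
      rfl
    have h4 : (1 : ℝ) ≤ 4 ^ l := one_le_pow₀ (by norm_num)
    have hexp : (m : ℝ) * t ^ 2 / (5 * (R / 2 ^ l) ^ 2) = 4 ^ l * (m * t ^ 2 / (5 * R ^ 2)) := by
      have : ((2 : ℝ) ^ l) ^ 2 = 4 ^ l := by rw [← pow_mul, mul_comm, pow_mul]; norm_num
      rw [div_pow, this]
      field_simp
    calc ((T l).card : ℝ) * (2 * exp (-(m * t ^ 2 / (5 * (R / 2 ^ l) ^ 2))))
        ≤ exp (4 ^ (l + 1) * Λ) * (2 * exp (-(4 ^ l * (4 * Λ + B)))) := by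
          rw [hexp]; gcongr
      _ = 2 * exp (-(4 ^ l * B)) := by
          rw [mul_left_comm, ← exp_add]; congr 2; ring
      _ ≤ 2 * exp (-B) := by
          gcongr
          nlinarith
      _ = δ / (ℓ + 1) := by
          rw [exp_neg, hB, exp_log (by positivity)]
          field_simp
  refine (measure_mono hsub).trans ((measure_biUnion_finset_le _ _).trans ?_)
  calc ∑ l ∈ Finset.range (ℓ + 1), diagMeasure ℓ m (⋃ u ∈ T l, bad l u)
      ≤ ∑ l ∈ Finset.range (ℓ + 1), ENNReal.ofReal (δ / (ℓ + 1)) :=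
        Finset.sum_le_sum fun l _ => (measure_biUnion_finset_le _ _).trans (hlevel l)
    _ = ENNReal.ofReal δ := by
        rw [Finset.sum_const, Finset.card_range, nsmul_eq_mul, ← ENNReal.ofReal_natCast,
          ← ENNReal.ofReal_mul (Nat.cast_nonneg _)]
        congr 1
        push_cast
        field_simp
theorem integral_abs_gaussianReal_le_one : ∫ x, |x| ∂(gaussianReal 0 1) ≤ 1 := by
  have h2 : ∫ x, x ^ 2 ∂(gaussianReal 0 1) = 1 := by
    have h := variance_id_gaussianReal (μ := 0) (v := 1)
    rw [variance_of_integral_eq_zero aemeasurable_id (by simp)] at h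
    simpa using h
  have hi2 : Integrable (fun x : ℝ => x ^ 2) (gaussianReal 0 1) := by
    by_contra hcon
    rw [integral_undef hcon] at h2
    exact zero_ne_one h2
  calc ∫ x, |x| ∂(gaussianReal 0 1) ≤ ∫ x, (1 + x ^ 2) / 2 ∂(gaussianReal 0 1) := by
        refine integral_mono_of_nonneg (ae_of_all _ fun x => abs_nonneg x)
          (((integrable_const 1).add hi2).div_const 2) (ae_of_all _ fun x => ?_)
        show |x| ≤ (1 + x ^ 2) / 2
        nlinarith [sq_nonneg (|x| - 1), sq_abs x]
    _ = 1 := by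
        rw [integral_div, integral_add (integrable_const 1) hi2, h2]
        simp

theorem lintegral_abs_gaussianReal_le_one :
    ∫⁻ x, ENNReal.ofReal |x| ∂(gaussianReal 0 1) ≤ 1 := by
  have hi : Integrable (fun x : ℝ => |x|) (gaussianReal 0 1) :=
    ((memLp_id_gaussianReal (μ := 0) (v := 1) 1).integrable (by simp)).abs
  rw [← ofReal_integral_eq_lintegral_ofReal hi (ae_of_all _ fun x => abs_nonneg x)]
  exact ENNReal.ofReal_le_one.2 integral_abs_gaussianReal_le_one

instance (ℓ m : ℕ) : IsProbabilityMeasure (diagMeasure ℓ m) := by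
  unfold diagMeasure
  infer_instance

theorem diagMeasure_sum_abs_gt_le (ℓ : ℕ) {m : ℕ} (hm : 0 < m) {δ : ℝ} (hδ : 0 < δ) :
    diagMeasure ℓ m {D | m * 2 ^ ℓ / δ < ∑ j, ∑ i, |D j i|} ≤ ENNReal.ofReal δ := by
  have hm' : (0 : ℝ) < m := by exact_mod_cast hm
  have hint : ∫⁻ D, ENNReal.ofReal (∑ j, ∑ i, |D j i|) ∂(diagMeasure ℓ m)
      ≤ ENNReal.ofReal (m * 2 ^ ℓ) := by
    have h1 : ∀ D : Fin m → Fin (2 ^ ℓ) → ℝ, ENNReal.ofReal (∑ j, ∑ i, |D j i|)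
        = ∑ j, ∑ i, ENNReal.ofReal |D j i| := by
      intro D
      rw [ENNReal.ofReal_sum_of_nonneg fun j _ => Finset.sum_nonneg fun i _ => abs_nonneg _]
      exact Finset.sum_congr rfl fun j _ => ENNReal.ofReal_sum_of_nonneg fun i _ => abs_nonneg _
    simp only [h1]
    rw [lintegral_finsetSum _ fun j _ => by fun_prop]
    have h2 : ∀ j : Fin m, ∫⁻ D, ∑ i, ENNReal.ofReal |D j i| ∂(diagMeasure ℓ m) ≤ 2 ^ ℓ := by
      intro j
      rw [lintegral_finsetSum _ fun i _ => by fun_prop]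
      refine (Finset.sum_le_sum fun i _ => ?_).trans (b := ∑ i : Fin (2 ^ ℓ), 1) (by simp)
      have hmp : MeasurePreserving (fun D : Fin m → Fin (2 ^ ℓ) → ℝ => D j i)
          (diagMeasure ℓ m) (gaussianReal 0 1) :=
        (measurePreserving_eval (fun _ : Fin (2 ^ ℓ) => gaussianReal 0 1) i).comp
          (measurePreserving_eval
            (fun _ : Fin m => Measure.pi fun _ : Fin (2 ^ ℓ) => gaussianReal 0 1) j)
      rw [hmp.lintegral_comp (f := fun x => ENNReal.ofReal |x|) (by fun_prop)]
      exact lintegral_abs_gaussianReal_le_one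
    refine (Finset.sum_le_sum fun j _ => h2 j).trans (le_of_eq ?_)
    rw [ENNReal.ofReal_mul hm'.le, ENNReal.ofReal_natCast, ENNReal.ofReal_pow zero_le_two]
    simp
  have hpos : 0 < (m : ℝ) * 2 ^ ℓ / δ := by positivity
  have hmarkov := meas_ge_le_lintegral_div (μ := diagMeasure ℓ m)
    (f := fun D => ENNReal.ofReal (∑ j, ∑ i, |D j i|))
    (Measurable.aemeasurable (by fun_prop))
    (ε := ENNReal.ofReal (m * 2 ^ ℓ / δ)) (by simpa using hpos) ENNReal.ofReal_ne_top
  refine (measure_mono fun D hD => ?_).trans (hmarkov.trans ?_)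
  · exact ENNReal.ofReal_le_ofReal (le_of_lt hD)
  · refine (ENNReal.div_le_div_right hint _).trans (le_of_eq ?_)
    rw [← ENNReal.ofReal_div_of_pos hpos]
    congr 1
    field_simp

theorem abs_hadDot_sub_le (ℓ : ℕ) {v w : Fin (2 ^ ℓ) → ℝ} {η : ℝ} (h : ∀ i, |v i - w i| ≤ η)
    (g : Fin (2 ^ ℓ) → ℝ) (k : Fin (2 ^ ℓ)) :
    |hadDot ℓ v g k - hadDot ℓ w g k| ≤ η * ∑ i, |g i| := by
  rw [hadDot, hadDot, ← Finset.sum_sub_distrib, Finset.mul_sum]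
  refine (Finset.abs_sum_le_sum_abs _ _).trans (Finset.sum_le_sum fun i _ => ?_)
  have hH : |Had ℓ k i| = 1 := by
    rw [← sq_eq_sq₀ (abs_nonneg _) zero_le_one, sq_abs, Had_sq, one_pow]
  rw [← sub_mul, ← mul_sub, abs_mul, abs_mul, hH, one_mul]
  exact mul_le_mul_of_nonneg_right (h i) (abs_nonneg _)

theorem abs_trigAvg_sub_le (ℓ : ℕ) (θ : Fin (2 ^ ℓ) → ℝ) {v w : Fin (2 ^ ℓ) → ℝ} {η : ℝ}
    (h : ∀ i, |v i - w i| ≤ η) (g : Fin (2 ^ ℓ) → ℝ) :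
    |trigAvg ℓ θ v g - trigAvg ℓ θ w g| ≤ η * ∑ i, |g i| := by
  have hcos : ∀ a b : ℝ, |cos a - cos b| ≤ |a - b| := fun a b => by
    simpa [Real.dist_eq] using LipschitzWith.dist_le_mul lipschitzWith_cos a b
  have hsum : |∑ k, (cos (θ k + hadDot ℓ v g k) - cos (θ k + hadDot ℓ w g k))|
      ≤ 2 ^ ℓ * (η * ∑ i, |g i|) := by
    refine (Finset.abs_sum_le_sum_abs _ _).trans ?_
    refine (Finset.sum_le_sum fun k _ => (hcos _ _).trans
      (le_of_eq (congrArg _ (add_sub_add_left_eq_sub _ _ _)) |>.trans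
        (abs_hadDot_sub_le ℓ h g k))).trans ?_
    simp
  rw [trigAvg, trigAvg, ← mul_sub, ← Finset.sum_sub_distrib, abs_mul, abs_of_pos (by positivity),
    inv_mul_le_iff₀ (by positivity)]
  exact hsum

theorem abs_featAvg_sub_le (ℓ m : ℕ) (θ D : Fin m → Fin (2 ^ ℓ) → ℝ) {v w : Fin (2 ^ ℓ) → ℝ}
    {η : ℝ} (h : ∀ i, |v i - w i| ≤ η) :
    |featAvg ℓ m θ D v - featAvg ℓ m θ D w| ≤ (m : ℝ)⁻¹ * (η * ∑ j, ∑ i, |D j i|) := by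
  rw [featAvg, featAvg, ← mul_sub, ← Finset.sum_sub_distrib, abs_mul, abs_of_nonneg (by positivity)]
  refine mul_le_mul_of_nonneg_left ?_ (by positivity)
  rw [Finset.mul_sum]
  exact (Finset.abs_sum_le_sum_abs _ _).trans
    (Finset.sum_le_sum fun j _ => abs_trigAvg_sub_le ℓ (θ j) h (D j))

theorem abs_featAvg_le_one (ℓ m : ℕ) (θ D : Fin m → Fin (2 ^ ℓ) → ℝ) (v : Fin (2 ^ ℓ) → ℝ) :
    |featAvg ℓ m θ D v| ≤ 1 := by
  rw [featAvg, abs_mul, abs_of_nonneg (by positivity)]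
  have h : |∑ j, trigAvg ℓ (θ j) v (D j)| ≤ m := by
    refine (Finset.abs_sum_le_sum_abs _ _).trans ?_
    refine (Finset.sum_le_sum fun j _ => abs_trigAvg_le_one ℓ _ _ _).trans ?_
    simp
  exact (mul_le_mul_of_nonneg_left h (by positivity)).trans (inv_mul_le_one)

theorem exists_finset_truncate {η R : ℝ} (hη : 0 < η) (hR : 0 ≤ R) :
    ∃ A : Finset ℝ, 0 ∈ A ∧ (A.card : ℝ) ≤ 2 * (R / η) + 1 ∧
      ∀ x : ℝ, |x| ≤ R → ∃ y ∈ A, |y| ≤ |x| ∧ |x - y| ≤ η := by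
  set K : ℕ := ⌊R / η⌋₊ with hK
  refine ⟨(Finset.Icc (-K : ℤ) K).image fun k : ℤ => η * (k : ℝ), ?_, ?_, ?_⟩
  · exact Finset.mem_image.2 ⟨0, by simp, by simp⟩
  · have h1 : ((Finset.Icc (-K : ℤ) K).image fun k : ℤ => η * (k : ℝ)).card ≤ 2 * K + 1 := by
      refine Finset.card_image_le.trans ?_
      rw [Int.card_Icc]
      omega
    have h2 : (K : ℝ) ≤ R / η := Nat.floor_le (by positivity)
    have h3 : ((((Finset.Icc (-K : ℤ) K).image fun k : ℤ => η * (k : ℝ)).card : ℕ) : ℝ)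
        ≤ 2 * K + 1 := by exact_mod_cast h1
    linarith
  · have key : ∀ x : ℝ, 0 ≤ x → x ≤ R → ∃ k : ℕ, k ≤ K ∧ η * k ≤ x ∧ x - η * k ≤ η := by
      intro x hx hxR
      refine ⟨⌊x / η⌋₊, Nat.floor_mono (by gcongr), ?_, ?_⟩
      · have := Nat.floor_le (div_nonneg hx hη.le)
        rw [le_div_iff₀ hη] at this
        linarith
      · have := (Nat.lt_floor_add_one (x / η)).le
        rw [div_le_iff₀ hη] at this
        linarith
    intro x hx
    obtain ⟨k, hkK, h1, h2⟩ := key |x| (abs_nonneg x) hx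
    have hk0 : 0 ≤ η * (k : ℝ) := by positivity
    rcases le_total 0 x with h | h
    · rw [abs_of_nonneg h] at h1 h2 ⊢
      refine ⟨η * k, Finset.mem_image.2 ⟨k, Finset.mem_Icc.2 ⟨by omega, by omega⟩, by simp⟩, ?_, ?_⟩
      · rwa [abs_of_nonneg hk0]
      · rwa [abs_of_nonneg (by linarith)]
    · rw [abs_of_nonpos h] at h1 h2 ⊢
      refine ⟨-(η * k), Finset.mem_image.2 ⟨-k, Finset.mem_Icc.2 ⟨by omega, by omega⟩, by simp⟩,
        ?_, ?_⟩
      · rwa [abs_neg, abs_of_nonneg hk0]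
      · rw [abs_of_nonpos (by linarith)]
        linarith

theorem abs_exp_neg_sub_exp_neg_le {a b : ℝ} (ha : 0 ≤ a) (hb : 0 ≤ b) :
    |exp (-a) - exp (-b)| ≤ |a - b| := by
  have key : ∀ {a b : ℝ}, 0 ≤ a → a ≤ b → exp (-a) - exp (-b) ≤ b - a := by
    intro a b ha hab
    have h1 : exp (-b) = exp (-a) * exp (a - b) := by rw [← exp_add]; ring_nf
    have h2 := add_one_le_exp (a - b)
    have h3 : exp (-a) ≤ 1 := exp_le_one_iff.2 (by linarith)
    have h4 := exp_pos (-a)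
    rw [h1]
    nlinarith
  rcases le_total a b with h | h
  · rw [abs_of_nonneg (sub_nonneg.2 (exp_le_exp.2 (neg_le_neg h))), abs_of_nonpos (by linarith)]
    linarith [key ha h]
  · rw [abs_of_nonpos (sub_nonpos.2 (exp_le_exp.2 (neg_le_neg h))), abs_of_nonneg (by linarith)]
    linarith [key hb h]

/-- Uniformly over the ball of radius `R`, the average `featAvg` is close to its value at the
origin multiplied by the Gaussian kernel. -/
theorem diagMeasure_exists_ball_le (ℓ : ℕ) {m : ℕ} (hm : 0 < m) (θ : Fin m → Fin (2 ^ ℓ) → ℝ)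
    {R ε δ : ℝ} (hR : 1 ≤ R) (hε : 0 < ε) (hε1 : ε ≤ 1) (hδ : 0 < δ) (hδ1 : δ ≤ 1)
    (hmε : 180 * (ℓ + 1) ^ 2 * R ^ 2 * log (5 * 2 ^ ℓ * R / (ε * δ)) ≤ m * ε ^ 2) :
    diagMeasure ℓ m {D | ∃ v : Fin (2 ^ ℓ) → ℝ, ∑ i, v i ^ 2 ≤ R ^ 2 ∧
      ε < |featAvg ℓ m θ D v - exp (-(∑ i, v i ^ 2) / 2) * featAvg ℓ m θ D 0|}
      ≤ ENNReal.ofReal δ := by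
  have hm' : (0 : ℝ) < m := by exact_mod_cast hm
  have hR0 : 0 < R := by linarith
  set d : ℝ := 2 ^ ℓ with hd
  have hd0 : 0 < d := by positivity
  have hd1 : 1 ≤ d := one_le_pow₀ one_le_two
  set η : ℝ := ε * δ / (8 * d * R) with hη
  have hη0 : 0 < η := by positivity
  set t : ℝ := ε / (2 * (ℓ + 1)) with ht
  have ht0 : 0 < t := by positivity
  obtain ⟨A, hA0, hAcard, hA⟩ := exists_finset_truncate hη0 hR0.le
  have hεδ0 : 0 < ε * δ := by positivity
  have hεδ : ε * δ ≤ 1 := mul_le_one₀ hε1 hδ.le hδ1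
  set L := log (5 * d * R / (ε * δ)) with hL
  have hgrid := diagMeasure_exists_grid_le ℓ hm θ A hA0 hR0 ht0.le (half_pos hδ) (by linarith)
    (by
      have hc0 : (0 : ℝ) < A.card := by exact_mod_cast Finset.card_pos.2 ⟨0, hA0⟩
      have h1 : log (d * A.card) ≤ 2 * L := by
        rw [hL, ← log_rpow (by positivity)]
        refine log_le_log (by positivity) ?_
        norm_cast
        have h2 : 2 * (R / η) + 1 ≤ 17 * d * R ^ 2 / (ε * δ) := by
          have e1 : R / η = 8 * d * R ^ 2 / (ε * δ) := by rw [hη]; field_simp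
          have e2 : 1 ≤ d * R ^ 2 / (ε * δ) := by
            rw [one_le_div hεδ0]
            nlinarith [one_le_pow₀ hR (n := 2)]
          rw [e1]
          have e3 : 17 * d * R ^ 2 / (ε * δ) = 2 * (8 * d * R ^ 2 / (ε * δ)) + d * R ^ 2 / (ε * δ) := by
            ring
          linarith
        calc d * A.card ≤ d * (17 * d * R ^ 2 / (ε * δ)) := by gcongr; linarith
          _ = 17 * d ^ 2 * R ^ 2 / (ε * δ) := by ring
          _ ≤ 25 * d ^ 2 * R ^ 2 / (ε * δ) ^ 2 := by
            gcongr
            · norm_num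
            · nlinarith
          _ = (5 * d * R / (ε * δ)) ^ 2 := by ring
      have h2 : log (2 * (ℓ + 1) / (δ / 2)) ≤ L := by
        refine log_le_log (by positivity) ?_
        have e1 : (ℓ : ℝ) + 1 ≤ d := by
          have := Nat.lt_two_pow_self (n := ℓ)
          rw [hd]
          exact_mod_cast this
        calc 2 * ((ℓ : ℝ) + 1) / (δ / 2) = 4 * (ℓ + 1) / δ := by ring
          _ ≤ 5 * d * R / δ := by
            refine div_le_div_of_nonneg_right ?_ hδ.le
            nlinarith
          _ ≤ 5 * d * R / (ε * δ) := by
            gcongr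
            nlinarith
      have h3 : m * t ^ 2 / (5 * R ^ 2) = m * ε ^ 2 / (20 * (ℓ + 1) ^ 2 * R ^ 2) := by
        rw [ht]; field_simp; norm_num
      rw [h3, le_div_iff₀ (by positivity)]
      have h4 : 4 * log (d * A.card) + log (2 * (ℓ + 1) / (δ / 2)) ≤ 9 * L := by linarith
      calc _ ≤ 9 * L * (20 * (ℓ + 1) ^ 2 * R ^ 2) := by gcongr
        _ = 180 * (ℓ + 1) ^ 2 * R ^ 2 * L := by ring
        _ ≤ _ := hmε)
  have habs := diagMeasure_sum_abs_gt_le ℓ hm (half_pos hδ)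
  refine (measure_mono (t := _ ∪ _) ?_).trans ((measure_union_le _ _).trans
    ((add_le_add hgrid habs).trans (le_of_eq ?_)))
  swap
  · rw [← ENNReal.ofReal_add (by positivity) (by positivity), add_halves]
  rintro D ⟨v, hv, hlt⟩
  by_contra hcon
  simp only [Set.mem_union, Set.mem_ofPred_eq, not_or, not_exists, not_and, not_lt] at hcon
  obtain ⟨hg, hs⟩ := hcon
  have hvi : ∀ i, |v i| ≤ R := by
    intro i
    refine abs_le_of_sq_le_sq ?_ hR0.le
    exact (Finset.single_le_sum (f := fun i => v i ^ 2) (fun i _ => sq_nonneg _)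
      (Finset.mem_univ i)).trans hv
  choose w hwA hwv hvw using fun i => hA (v i) (hvi i)
  have hsq : ∀ i, w i ^ 2 ≤ v i ^ 2 := fun i => sq_le_sq.2 (hwv i)
  have hgw := hg w hwA ((Finset.sum_le_sum fun i _ => hsq i).trans hv)
  have h1 : |featAvg ℓ m θ D v - featAvg ℓ m θ D w| ≤ ε / 4 := by
    refine (abs_featAvg_sub_le ℓ m θ D hvw).trans ?_
    calc (m : ℝ)⁻¹ * (η * ∑ j, ∑ i, |D j i|) ≤ (m : ℝ)⁻¹ * (η * (m * d / (δ / 2))) := by gcongr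
      _ = ε / (4 * R) := by rw [hη]; field_simp; norm_num
      _ ≤ ε / 4 := by gcongr; linarith
  have h2 : |exp (-(∑ i, v i ^ 2) / 2) - exp (-(∑ i, w i ^ 2) / 2)| ≤ ε / 8 := by
    rw [neg_div, neg_div]
    refine (abs_exp_neg_sub_exp_neg_le (by positivity) (by positivity)).trans ?_
    rw [← sub_div, ← Finset.sum_sub_distrib, abs_of_nonneg
      (div_nonneg (Finset.sum_nonneg fun i _ => sub_nonneg.2 (hsq i)) zero_le_two)]
    have h3 : ∀ i, v i ^ 2 - w i ^ 2 ≤ 2 * R * η := by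
      intro i
      have e1 : v i ^ 2 - w i ^ 2 ≤ |v i - w i| * |v i + w i| := by
        rw [← abs_mul]
        exact (le_of_eq (by ring)).trans (le_abs_self _)
      have e2 : |v i + w i| ≤ 2 * R := by
        linarith [abs_add_le (v i) (w i), hvi i, hwv i]
      calc _ ≤ |v i - w i| * |v i + w i| := e1
        _ ≤ η * (2 * R) := by
          gcongr
          exact hvw i
        _ = _ := by ring
    have h4 : ∑ i, (v i ^ 2 - w i ^ 2) ≤ d * (2 * R * η) := by
      refine (Finset.sum_le_sum fun i _ => h3 i).trans (le_of_eq ?_)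
      simp [hd]
    have h5 : d * (2 * R * η) = ε * δ / 4 := by rw [hη]; field_simp; norm_num
    nlinarith
  have h3 : ((ℓ : ℝ) + 1) * t = ε / 2 := by rw [ht]; field_simp
  rw [h3] at hgw
  have h4 : |(exp (-(∑ i, v i ^ 2) / 2) - exp (-(∑ i, w i ^ 2) / 2)) * featAvg ℓ m θ D 0|
      ≤ ε / 8 := by
    rw [abs_mul]
    calc _ ≤ ε / 8 * 1 := mul_le_mul h2 (abs_featAvg_le_one _ _ _ _ _) (abs_nonneg _) (by positivity)
      _ = _ := mul_one _
  have h5 : featAvg ℓ m θ D v - exp (-(∑ i, v i ^ 2) / 2) * featAvg ℓ m θ D 0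
      = (featAvg ℓ m θ D v - featAvg ℓ m θ D w)
        + (featAvg ℓ m θ D w - exp (-(∑ i, w i ^ 2) / 2) * featAvg ℓ m θ D 0)
        - (exp (-(∑ i, v i ^ 2) / 2) - exp (-(∑ i, w i ^ 2) / 2)) * featAvg ℓ m θ D 0 := by
    ring
  rw [h5] at hlt
  rw [abs_le] at h1 hgw h4
  have h6 : |(featAvg ℓ m θ D v - featAvg ℓ m θ D w)
        + (featAvg ℓ m θ D w - exp (-(∑ i, w i ^ 2) / 2) * featAvg ℓ m θ D 0)
        - (exp (-(∑ i, v i ^ 2) / 2) - exp (-(∑ i, w i ^ 2) / 2)) * featAvg ℓ m θ D 0| ≤ ε := by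
    rw [abs_le]
    constructor <;> linarith
  linarith

/-- The uniform probability measure on `[0, 2π]`. -/
abbrev uniformPhase : Measure ℝ :=
  (ENNReal.ofReal (2 * π))⁻¹ • volume.restrict (Set.Icc (0 : ℝ) (2 * π))

instance : IsProbabilityMeasure uniformPhase := by
  constructor
  have h : ENNReal.ofReal (2 * π) ≠ 0 := by simpa using pi_pos
  simp only [uniformPhase, Measure.smul_apply, Measure.restrict_apply_univ, Real.volume_Icc,
    sub_zero, smul_eq_mul]
  exact ENNReal.inv_mul_cancel h ENNReal.ofReal_ne_top

instance (ℓ m : ℕ) : IsProbabilityMeasure (phaseMeasure ℓ m) := by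
  have h : phaseMeasure ℓ m = Measure.pi fun _ => Measure.pi fun _ => uniformPhase := rfl
  rw [h]
  infer_instance

/-- Translation by `s` modulo `2π` preserves the uniform measure. -/
theorem exists_measurePreserving_uniformPhase (s : ℝ) :
    ∃ T : ℝ → ℝ, MeasurePreserving T uniformPhase uniformPhase ∧
      ∀ x, ∃ n : ℤ, T x = x + s + n * (2 * π) := by
  have : Fact (0 < 2 * π) := ⟨two_pi_pos⟩
  have hIoc : volume.restrict (Set.Ioc (0 : ℝ) (0 + 2 * π))
      = volume.restrict (Set.Icc (0 : ℝ) (2 * π)) := by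
    rw [zero_add, restrict_Ioc_eq_restrict_Icc]
  have h1 := AddCircle.measurePreserving_mk (2 * π) 0
  have h2 := measurePreserving_add_right (volume : Measure (AddCircle (2 * π)))
    ((s : ℝ) : AddCircle (2 * π))
  have h3 := AddCircle.measurePreserving_equivIoc (2 * π) (a := 0)
  have h4 := measurePreserving_subtype_coe (μa := (volume : Measure ℝ))
    (measurableSet_Ioc (a := (0 : ℝ)) (b := 0 + 2 * π))
  have h := h4.comp (h3.comp (h2.comp h1))
  rw [hIoc] at h
  refine ⟨_, h.smul_measure _, fun x => ⟨-toIocDiv two_pi_pos 0 (x + s), ?_⟩⟩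
  have h5 : (((AddCircle.equivIoc (2 * π) 0) ((x : AddCircle (2 * π)) + (s : AddCircle (2 * π))) :
      Set.Ioc (0 : ℝ) (0 + 2 * π)) : ℝ) = toIocMod two_pi_pos 0 (x + s) := by
    rfl
  simp only [Function.comp_apply, h5, toIocMod, zsmul_eq_mul, Int.cast_neg]
  ring

theorem phaseMeasure_add_mem (ℓ m : ℕ) {S : Set (Fin m → Fin (2 ^ ℓ) → ℝ)} (hS : MeasurableSet S)
    (hper : ∀ b b', (∀ j k, ∃ n : ℤ, b' j k = b j k + n * (2 * π)) → (b' ∈ S ↔ b ∈ S))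
    (s : Fin m → Fin (2 ^ ℓ) → ℝ) :
    phaseMeasure ℓ m {b | b + s ∈ S} = phaseMeasure ℓ m S := by
  choose T hT hTn using exists_measurePreserving_uniformPhase
  have hmp : MeasurePreserving
      (fun (b : Fin m → Fin (2 ^ ℓ) → ℝ) j k => T (s j k) (b j k))
      (phaseMeasure ℓ m) (phaseMeasure ℓ m) :=
    measurePreserving_pi (fun _ => Measure.pi fun _ => uniformPhase)
      (fun _ => Measure.pi fun _ => uniformPhase) (f := fun j b k => T (s j k) (b k)) fun j =>
        measurePreserving_pi (fun _ => uniformPhase) (fun _ => uniformPhase) fun k => hT (s j k)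
  rw [← hmp.measure_preimage hS.nullMeasurableSet]
  congr 1
  ext b
  exact (hper _ _ fun j k => hTn (s j k) (b j k)).symm

theorem diagMeasure_prod_phaseMeasure_add_mem (ℓ m : ℕ)
    {S : Set ((Fin m → Fin (2 ^ ℓ) → ℝ) × (Fin m → Fin (2 ^ ℓ) → ℝ))} (hS : MeasurableSet S)
    (hper : ∀ D b b', (∀ j k, ∃ n : ℤ, b' j k = b j k + n * (2 * π)) →
      ((D, b') ∈ S ↔ (D, b) ∈ S))
    {s : (Fin m → Fin (2 ^ ℓ) → ℝ) → Fin m → Fin (2 ^ ℓ) → ℝ} (hs : Measurable s) :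
    ((diagMeasure ℓ m).prod (phaseMeasure ℓ m)) ((fun p => (p.1, p.2 + s p.1)) ⁻¹' S)
      = ((diagMeasure ℓ m).prod (phaseMeasure ℓ m)) S := by
  have hmeas : Measurable fun p : (Fin m → Fin (2 ^ ℓ) → ℝ) × (Fin m → Fin (2 ^ ℓ) → ℝ) =>
      (p.1, p.2 + s p.1) :=
    measurable_fst.prodMk (measurable_snd.add (hs.comp measurable_fst))
  rw [Measure.prod_apply (hmeas hS), Measure.prod_apply hS]
  refine lintegral_congr fun D => ?_
  exact phaseMeasure_add_mem ℓ m (measurable_prodMk_left hS) (hper D) (s D)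

theorem integral_cos_two_mul_uniformPhase : ∫ x, cos (2 * x) ∂uniformPhase = 0 := by
  rw [integral_smul_measure, ← restrict_Ioc_eq_restrict_Icc,
    ← intervalIntegral.integral_of_le two_pi_pos.le,
    intervalIntegral.integral_comp_mul_left _ two_ne_zero, integral_cos]
  have h : sin (2 * (2 * π)) = 0 := by
    have := sin_nat_mul_pi 4
    rw [← this]; congr 1; push_cast; ring
  simp [h]

theorem featAvg_zero (ℓ m : ℕ) (θ D : Fin m → Fin (2 ^ ℓ) → ℝ) :
    featAvg ℓ m θ D 0 = (m : ℝ)⁻¹ * ∑ j, (2 ^ ℓ : ℝ)⁻¹ * ∑ k, cos (θ j k) := by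
  simp [featAvg, trigAvg, hadDot]

theorem phaseMeasure_featAvg_zero_le (ℓ : ℕ) {m : ℕ} (hm : 0 < m) (D : Fin m → Fin (2 ^ ℓ) → ℝ)
    {t : ℝ} (ht : 0 ≤ t) :
    phaseMeasure ℓ m {b | t < |featAvg ℓ m ((2 : ℝ) • b) D 0|}
      ≤ ENNReal.ofReal (2 * exp (-(m * t ^ 2 / 2))) := by
  let f : (Fin (2 ^ ℓ) → ℝ) → ℝ := fun b => (2 ^ ℓ : ℝ)⁻¹ * ∑ k, cos (2 * b k)
  have hfc : Continuous f := by fun_prop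
  have hbound : ∀ b, f b ∈ Set.Icc (-1 : ℝ) 1 := by
    intro b
    have h := abs_trigAvg_le_one ℓ ((2 : ℝ) • b) 0 0
    rw [trigAvg] at h
    simpa [f, hadDot] using abs_le.1 h
  have hint : ∫ b, f b ∂(Measure.pi fun _ => uniformPhase) = 0 := by
    simp only [f]
    rw [integral_const_mul, integral_finsetSum]
    · rw [Finset.sum_eq_zero, mul_zero]
      intro k _
      have h := (measurePreserving_eval (fun _ : Fin (2 ^ ℓ) => uniformPhase) k).map_eq
      have h2 := integral_map (μ := Measure.pi fun _ : Fin (2 ^ ℓ) => uniformPhase)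
        (φ := fun b => b k) (f := fun x => cos (2 * x)) (measurable_pi_apply k).aemeasurable
        (Continuous.aestronglyMeasurable (by fun_prop))
      rw [← h2]
      exact (congrArg (fun ν => ∫ x, cos (2 * x) ∂ν) h).trans integral_cos_two_mul_uniformPhase
    · intro k _
      exact Integrable.of_bound (C := 1) (Continuous.aestronglyMeasurable (by fun_prop))
        (ae_of_all _ fun b => abs_cos_le_one _)
  have hsub := hasSubgaussianMGF_of_mem_Icc_of_integral_eq_zero
    (μ := Measure.pi fun _ : Fin (2 ^ ℓ) => uniformPhase) hfc.measurable.aemeasurable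
    (ae_of_all _ hbound) hint
  have h := measure_pi_abs_average_gt_le hm (f := fun _ => f) (fun _ => hsub) ht
  have hset : {b : Fin m → Fin (2 ^ ℓ) → ℝ | t < |featAvg ℓ m ((2 : ℝ) • b) D 0|}
      = {b | t < |(m : ℝ)⁻¹ * ∑ j, f (b j)|} := by
    ext b
    simp [featAvg_zero, f]
  rw [hset]
  refine h.trans (le_of_eq ?_)
  congr 5
  have : ‖(1 : ℝ) - -1‖₊ = 2 := by
    ext
    norm_num
  rw [this]
  norm_num

theorem continuous_featAvg_two_smul (ℓ m : ℕ) (w : Fin (2 ^ ℓ) → ℝ) :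
    Continuous fun p : (Fin m → Fin (2 ^ ℓ) → ℝ) × (Fin m → Fin (2 ^ ℓ) → ℝ) =>
      featAvg ℓ m ((2 : ℝ) • p.2) p.1 w := by
  simp only [featAvg, trigAvg, hadDot, Pi.smul_apply, smul_eq_mul]
  fun_prop

theorem featAvg_two_smul_eq (ℓ m : ℕ) {b b' : Fin m → Fin (2 ^ ℓ) → ℝ}
    (h : ∀ j k, ∃ n : ℤ, b' j k = b j k + n * (2 * π)) (D : Fin m → Fin (2 ^ ℓ) → ℝ)
    (w : Fin (2 ^ ℓ) → ℝ) :
    featAvg ℓ m ((2 : ℝ) • b') D w = featAvg ℓ m ((2 : ℝ) • b) D w := by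
  simp only [featAvg, trigAvg, Pi.smul_apply, smul_eq_mul]
  congr 1
  refine Finset.sum_congr rfl fun j _ => ?_
  congr 1
  refine Finset.sum_congr rfl fun k _ => ?_
  obtain ⟨n, hn⟩ := h j k
  rw [hn, ← cos_add_int_mul_two_pi (2 * b j k + _) (2 * n)]
  congr 1
  push_cast
  ring

theorem rht_eq_hadDot (ℓ m : ℕ) (D : Fin m → Fin (2 ^ ℓ) → ℝ)
    (z : EuclideanSpace ℝ (Fin (2 ^ ℓ))) (j : Fin m) (k : Fin (2 ^ ℓ)) :
    rht ℓ m D z j k = hadDot ℓ z (D j) k := by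
  simp only [rht, hadDot, Matrix.mulVec, dotProduct]
  exact Finset.sum_congr rfl fun i _ => by ring

theorem hadDot_sub (ℓ : ℕ) (v w g : Fin (2 ^ ℓ) → ℝ) (k : Fin (2 ^ ℓ)) :
    hadDot ℓ (v - w) g k = hadDot ℓ v g k - hadDot ℓ w g k := by
  rw [eq_sub_iff_add_eq, ← hadDot_add, sub_add_cancel]

/-- The inner product of two feature vectors splits into a phase-free average at `x - y` and an
average at `x + y - 2z` whose phases are shifted by the transform of `z`. -/
theorem inner_features_eq (ℓ m : ℕ) (D b : Fin m → Fin (2 ^ ℓ) → ℝ)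
    (x y z : EuclideanSpace ℝ (Fin (2 ^ ℓ))) :
    (2 / ((m : ℝ) * 2 ^ ℓ)) * ∑ j, ∑ k, cos (rht ℓ m D x j k + b j k) *
        cos (rht ℓ m D y j k + b j k)
      = featAvg ℓ m 0 D (⇑x - ⇑y)
        + featAvg ℓ m ((2 : ℝ) • (b + rht ℓ m D z)) D ((⇑x - ⇑z) + (⇑y - ⇑z)) := by
  have hfeat : ∀ θ v, featAvg ℓ m θ D v
      = ((m : ℝ) * 2 ^ ℓ)⁻¹ * ∑ j, ∑ k, cos (θ j k + hadDot ℓ v (D j) k) := by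
    intro θ v
    simp only [featAvg, trigAvg, ← Finset.mul_sum]
    rw [← mul_assoc, ← mul_inv]
  rw [hfeat, hfeat, ← mul_add, ← Finset.sum_add_distrib, div_eq_inv_mul, mul_assoc, Finset.mul_sum]
  congr 1
  refine Finset.sum_congr rfl fun j _ => ?_
  rw [← Finset.sum_add_distrib, Finset.mul_sum]
  refine Finset.sum_congr rfl fun k _ => ?_
  simp only [rht_eq_hadDot, hadDot_add, hadDot_sub, Pi.smul_apply, Pi.add_apply, Pi.zero_apply,
    smul_eq_mul, zero_add]
  rw [← mul_assoc, two_mul_cos_mul_cos]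
  congr 2 <;> ring

/-- The pairs of diagonals and phases for which `featAvg`, with the doubled phases, either deviates
from its value at the origin multiplied by the Gaussian kernel somewhere on the ball of radius `R`,
or is large at the origin. -/
def phaseBad (ℓ m : ℕ) (R ε : ℝ) :
    Set ((Fin m → Fin (2 ^ ℓ) → ℝ) × (Fin m → Fin (2 ^ ℓ) → ℝ)) :=
  {p | ∃ w : Fin (2 ^ ℓ) → ℝ, ∑ i, w i ^ 2 ≤ R ^ 2 ∧ ε < |featAvg ℓ m ((2 : ℝ) • p.2) p.1 w
      - exp (-(∑ i, w i ^ 2) / 2) * featAvg ℓ m ((2 : ℝ) • p.2) p.1 0|} ∪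
    {p | ε < |featAvg ℓ m ((2 : ℝ) • p.2) p.1 0|}

theorem measure_phaseBad_le (ℓ : ℕ) {m : ℕ} (hm : 0 < m)
    {R ε δ : ℝ} (hR : 1 ≤ R) (hε : 0 < ε) (hε1 : ε ≤ 1) (hδ : 0 < δ) (hδ1 : δ ≤ 1)
    (hmε : 180 * (ℓ + 1) ^ 2 * R ^ 2 * log (5 * 2 ^ ℓ * R / (ε * δ)) ≤ m * ε ^ 2)
    (hmδ : 2 * exp (-(m * ε ^ 2 / 2)) ≤ δ) (z : EuclideanSpace ℝ (Fin (2 ^ ℓ))) :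
    ((diagMeasure ℓ m).prod (phaseMeasure ℓ m))
        ((fun p => (p.1, p.2 + rht ℓ m p.1 z)) ⁻¹' phaseBad ℓ m R ε)
      ≤ ENNReal.ofReal δ + ENNReal.ofReal δ := by
  have hopen₀ : IsOpen {p : (Fin m → Fin (2 ^ ℓ) → ℝ) × (Fin m → Fin (2 ^ ℓ) → ℝ) |
      ε < |featAvg ℓ m ((2 : ℝ) • p.2) p.1 0|} :=
    isOpen_lt continuous_const (continuous_featAvg_two_smul ℓ m 0).abs
  have hopen₁ : IsOpen {p : (Fin m → Fin (2 ^ ℓ) → ℝ) × (Fin m → Fin (2 ^ ℓ) → ℝ) |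
      ∃ w : Fin (2 ^ ℓ) → ℝ, ∑ i, w i ^ 2 ≤ R ^ 2 ∧ ε < |featAvg ℓ m ((2 : ℝ) • p.2) p.1 w
        - exp (-(∑ i, w i ^ 2) / 2) * featAvg ℓ m ((2 : ℝ) • p.2) p.1 0|} := by
    simp only [Set.ofPred_exists, Set.ofPred_and]
    exact isOpen_iUnion fun w => isOpen_const.inter (isOpen_lt continuous_const
      ((continuous_featAvg_two_smul ℓ m w).sub
        (continuous_const.mul (continuous_featAvg_two_smul ℓ m 0))).abs)
  have hrht : Continuous fun D => rht ℓ m D z := by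
    refine continuous_pi fun j => continuous_pi fun k => ?_
    simp only [rht_eq_hadDot, hadDot]
    fun_prop
  rw [phaseBad, diagMeasure_prod_phaseMeasure_add_mem ℓ m (hopen₁.union hopen₀).measurableSet ?_
    hrht.measurable]
  · refine (measure_union_le _ _).trans (add_le_add ?_ ?_)
    · rw [Measure.prod_apply_symm hopen₁.measurableSet]
      refine (lintegral_mono fun b => diagMeasure_exists_ball_le ℓ hm ((2 : ℝ) • b) hR hε hε1
        hδ hδ1 hmε).trans ?_
      simp
    · rw [Measure.prod_apply hopen₀.measurableSet]
      refine (lintegral_mono fun D => (phaseMeasure_featAvg_zero_le ℓ hm D hε.le).trans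
        (ENNReal.ofReal_le_ofReal hmδ)).trans ?_
      simp
  · intro D b b' h
    simp only [Set.mem_union, Set.mem_ofPred_eq, featAvg_two_smul_eq ℓ m h]

theorem sum_sq_le_of_norm_le {ι : Type*} [Fintype ι] {z : EuclideanSpace ℝ ι} {R : ℝ}
    (h : ‖z‖ ≤ R) : ∑ i, z i ^ 2 ≤ R ^ 2 := by
  rw [← EuclideanSpace.real_norm_sq_eq]
  exact pow_le_pow_left₀ (norm_nonneg _) h 2

/-- The logarithmic factor dominates every quantity entering the sample size. -/
theorem sample_size_bounds (ℓ : ℕ) {ε δ Δ M : ℝ} (hε : ε ∈ Set.Ioo (0 : ℝ) (1 / 2))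
    (hδ : δ ∈ Set.Ioo (0 : ℝ) (1 / 2)) (hΔ : 0 ≤ Δ)
    (hM : 1000000 * ε⁻¹ ^ 2 * (1 + Δ) ^ 2 * log (2 ^ ℓ * (1 + Δ) / (ε * δ)) ^ 3 ≤ M) :
    0 < M ∧
    180 * ((ℓ : ℝ) + 1) ^ 2 * (2 * (1 + Δ)) ^ 2 *
      log (5 * 2 ^ ℓ * (2 * (1 + Δ)) / (ε / 4 * (δ / 4))) ≤ M * (ε / 4) ^ 2 ∧
    2 * exp (-(M * (ε / 4) ^ 2 / 2)) ≤ δ / 4 := by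
  obtain ⟨hε0, hε1⟩ := hε
  obtain ⟨hδ0, hδ1⟩ := hδ
  set d : ℝ := 2 ^ ℓ with hd
  have hd1 : 1 ≤ d := one_le_pow₀ one_le_two
  set Q : ℝ := d * (1 + Δ) / (ε * δ) with hQ
  have hεδ : 0 < ε * δ := mul_pos hε0 hδ0
  have hQd : 4 * d ≤ Q := by
    rw [hQ, le_div_iff₀ hεδ]
    have : ε * δ ≤ 1 / 4 := by nlinarith
    nlinarith
  have hQδ : 1 / δ ≤ Q := by
    rw [hQ, div_le_div_iff₀ hδ0 hεδ]
    have h1 : ε * δ ≤ 1 * δ := by nlinarith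
    have h2 : 1 ≤ d * (1 + Δ) := by nlinarith
    nlinarith
  have hQ4 : 4 ≤ Q := by linarith
  have hQ0 : 0 < Q := by linarith
  have hl2 := log_two_gt_d9
  have hlog4 : log 4 = 2 * log 2 := by
    rw [show (4 : ℝ) = 2 ^ 2 by norm_num, log_pow]; norm_num
  set L := log Q with hL
  have hLℓ : (ℓ : ℝ) + 1 ≤ 2 * L := by
    have h1 : log (4 * d) ≤ L := log_le_log (by positivity) hQd
    rw [log_mul (by norm_num) (by positivity), hlog4, hd, log_pow] at h1
    have : (0 : ℝ) ≤ ℓ := Nat.cast_nonneg ℓ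
    nlinarith
  have hL4 : log 4 ≤ L := log_le_log (by norm_num) hQ4
  have hL1 : 1 ≤ L := by linarith
  have hL160 : log (5 * d * (2 * (1 + Δ)) / (ε / 4 * (δ / 4))) ≤ 5 * L := by
    have e1 : 5 * d * (2 * (1 + Δ)) / (ε / 4 * (δ / 4)) = 160 * Q := by
      rw [hQ]; field_simp; norm_num
    have e2 : log 160 ≤ 4 * log 4 := by
      rw [show 4 * log 4 = log (4 ^ 4) by rw [log_pow]; norm_num]
      exact log_le_log (by norm_num) (by norm_num)
    rw [e1, log_mul (by norm_num) hQ0.ne']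
    linarith
  have hMε : 1000000 * (1 + Δ) ^ 2 * L ^ 3 ≤ M * ε ^ 2 := by
    have h1 := mul_le_mul_of_nonneg_right hM (sq_nonneg ε)
    refine (le_of_eq ?_).trans h1
    field_simp
  have hL3 : L ≤ L ^ 3 := le_self_pow₀ hL1 (by norm_num)
  have hΔ2 : 1 ≤ (1 + Δ) ^ 2 := one_le_pow₀ (by linarith)
  refine ⟨lt_of_lt_of_le (by positivity) hM, ?_, ?_⟩
  · calc 180 * ((ℓ : ℝ) + 1) ^ 2 * (2 * (1 + Δ)) ^ 2 *
          log (5 * d * (2 * (1 + Δ)) / (ε / 4 * (δ / 4)))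
        ≤ 180 * ((ℓ : ℝ) + 1) ^ 2 * (2 * (1 + Δ)) ^ 2 * (5 * L) := by gcongr
      _ ≤ 180 * (2 * L) ^ 2 * (2 * (1 + Δ)) ^ 2 * (5 * L) := by gcongr
      _ = 14400 * ((1 + Δ) ^ 2 * L ^ 3) := by ring
      _ ≤ M * (ε / 4) ^ 2 := by
        have : 0 ≤ (1 + Δ) ^ 2 * L ^ 3 := by positivity
        nlinarith
  · have h1 : log (8 / δ) ≤ 3 * L := by
      have e1 : log 8 ≤ 2 * log 4 := by
        rw [show 2 * log 4 = log (4 ^ 2) by rw [log_pow]; norm_num]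
        exact log_le_log (by norm_num) (by norm_num)
      have e2 : log (1 / δ) ≤ L := log_le_log (by positivity) hQδ
      rw [show 8 / δ = 8 * (1 / δ) by ring, log_mul (by norm_num) (by positivity)]
      linarith
    have h2 : L ≤ (1 + Δ) ^ 2 * L ^ 3 := by nlinarith
    have h3 : log (8 / δ) ≤ M * (ε / 4) ^ 2 / 2 := by nlinarith
    have h4 : exp (-(M * (ε / 4) ^ 2 / 2)) ≤ δ / 8 := by
      rw [← log_le_log_iff (exp_pos _) (by positivity), log_exp]
      have : log (δ / 8) = -log (8 / δ) := by rw [← log_inv, inv_div]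
      linarith
    linarith

/-- Theorem 1.2: uniform approximation of the RBF kernel by random
Fourier features built from randomized Hadamard transforms.  Here
`⟨h(x), h(y)⟩ = (2/(md)) ∑_{j,k} cos(h̃_{j,k}(x) + b^j_k) · cos(h̃_{j,k}(y) + b^j_k)`. -/
theorem kernel_approximation_rht :
    ∃ C : ℝ, 0 < C ∧ ∃ c : ℕ, 0 < c ∧
      ∀ (ℓ : ℕ) (ε δ : ℝ), ε ∈ Set.Ioo (0 : ℝ) (1 / 2) → δ ∈ Set.Ioo (0 : ℝ) (1 / 2) →
        ∀ W : Set (EuclideanSpace ℝ (Fin (2 ^ ℓ))), Bornology.IsBounded W →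
          ∀ m : ℕ,
            C * ε⁻¹ ^ 2 * (1 + Metric.diam W) ^ 2 *
                Real.log (2 ^ ℓ * (1 + Metric.diam W) / (ε * δ)) ^ c ≤ (m : ℝ) →
            ENNReal.ofReal (1 - δ) ≤
              ((diagMeasure ℓ m).prod (phaseMeasure ℓ m))
                {p | ∀ x ∈ W, ∀ y ∈ W,
                  |(2 / ((m : ℝ) * 2 ^ ℓ)) *
                      ∑ j, ∑ k, Real.cos (rht ℓ m p.1 x j k + p.2 j k) *
                        Real.cos (rht ℓ m p.1 y j k + p.2 j k) -
                    Real.exp (-‖x - y‖ ^ 2 / 2)| ≤ ε} := by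
  refine ⟨1000000, by norm_num, 3, by norm_num, ?_⟩
  intro ℓ ε δ hε hδ W hW m hm
  rcases W.eq_empty_or_nonempty with rfl | ⟨z, hz⟩
  · simpa using hδ.1.le
  set Δ := Metric.diam W with hΔ
  have hΔ0 : 0 ≤ Δ := Metric.diam_nonneg
  obtain ⟨hm0, hmε, hmδ⟩ := sample_size_bounds ℓ hε hδ hΔ0 hm
  obtain ⟨hε0, hε1⟩ := hε
  obtain ⟨hδ0, hδ1⟩ := hδ
  have hm' : 0 < m := by exact_mod_cast hm0
  set R : ℝ := 2 * (1 + Δ) with hR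
  have hR1 : 1 ≤ R := by linarith
  set μ := (diagMeasure ℓ m).prod (phaseMeasure ℓ m) with hμ
  let B₁ : Set (Fin m → Fin (2 ^ ℓ) → ℝ) := {D | ∃ v : Fin (2 ^ ℓ) → ℝ, ∑ i, v i ^ 2 ≤ R ^ 2 ∧
    ε / 4 < |featAvg ℓ m 0 D v - exp (-(∑ i, v i ^ 2) / 2) * featAvg ℓ m 0 D 0|}
  let B₂ : Set ((Fin m → Fin (2 ^ ℓ) → ℝ) × (Fin m → Fin (2 ^ ℓ) → ℝ)) :=
    (fun p => (p.1, p.2 + rht ℓ m p.1 z)) ⁻¹' phaseBad ℓ m R (ε / 4)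
  have hB₁ : μ (B₁ ×ˢ Set.univ) ≤ ENNReal.ofReal (δ / 4) := by
    rw [hμ, Measure.prod_prod, measure_univ, mul_one]
    exact diagMeasure_exists_ball_le ℓ hm' 0 hR1 (by linarith) (by linarith) (by linarith)
      (by linarith) hmε
  have hB₂ : μ B₂ ≤ ENNReal.ofReal (δ / 4) + ENNReal.ofReal (δ / 4) :=
    measure_phaseBad_le ℓ hm' hR1 (by linarith) (by linarith) (by linarith) (by linarith) hmε hmδ z
  have hcover : (Set.univ : Set ((Fin m → Fin (2 ^ ℓ) → ℝ) × (Fin m → Fin (2 ^ ℓ) → ℝ)))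
      ⊆ {p | ∀ x ∈ W, ∀ y ∈ W,
          |(2 / ((m : ℝ) * 2 ^ ℓ)) *
              ∑ j, ∑ k, Real.cos (rht ℓ m p.1 x j k + p.2 j k) *
                Real.cos (rht ℓ m p.1 y j k + p.2 j k) -
            Real.exp (-‖x - y‖ ^ 2 / 2)| ≤ ε} ∪ (B₁ ×ˢ Set.univ ∪ B₂) := by
    intro p _
    by_cases hbad : p ∈ B₁ ×ˢ Set.univ ∪ B₂
    · exact Or.inr hbad
    refine Or.inl fun x hx y hy => ?_
    simp only [B₁, B₂, phaseBad, Set.mem_union, Set.mem_prod, Set.mem_univ, and_true,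
      Set.mem_preimage, Set.mem_ofPred_eq, not_or, not_exists, not_and, not_lt] at hbad
    obtain ⟨h₁, h₂, h₃⟩ := hbad
    have hdist : ∀ u ∈ W, ∀ v ∈ W, ‖u - v‖ ≤ Δ := fun u hu v hv => by
      rw [← dist_eq_norm]
      exact Metric.dist_le_diam_of_mem hW hu hv
    have g₁ := h₁ (⇑x - ⇑y) (sum_sq_le_of_norm_le (z := x - y) (by linarith [hdist x hx y hy]))
    have g₂ := h₂ ((⇑x - ⇑z) + (⇑y - ⇑z)) (sum_sq_le_of_norm_le (z := (x - z) + (y - z)) (by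
      linarith [norm_add_le (x - z) (y - z), hdist x hx z hz, hdist y hy z hz]))
    have hnorm : ∑ i, (⇑x - ⇑y) i ^ 2 = ‖x - y‖ ^ 2 :=
      (EuclideanSpace.real_norm_sq_eq (x - y)).symm
    have hone : featAvg ℓ m 0 p.1 0 = 1 := by
      rw [featAvg_zero]
      simp [hm0.ne']
    rw [hnorm, hone, mul_one] at g₁
    rw [inner_features_eq ℓ m p.1 p.2 x y z]
    set E := exp (-(∑ i, ((⇑x - ⇑z) + (⇑y - ⇑z)) i ^ 2) / 2) with hE
    have hE1 : E ≤ 1 := exp_le_one_iff.2 (div_nonpos_of_nonpos_of_nonneg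
      (neg_nonpos.2 (Finset.sum_nonneg fun i _ => sq_nonneg _)) zero_le_two)
    set G := featAvg ℓ m ((2 : ℝ) • (p.2 + rht ℓ m p.1 z)) p.1 0
    have hEG : |E * G| ≤ ε / 4 := by
      rw [abs_mul, abs_of_pos (exp_pos _)]
      exact (mul_le_of_le_one_left (abs_nonneg _) hE1).trans h₃
    rw [abs_le] at g₁ g₂ hEG ⊢
    constructor <;> linarith
  have hone : 1 ≤ μ {p | ∀ x ∈ W, ∀ y ∈ W,
          |(2 / ((m : ℝ) * 2 ^ ℓ)) *
              ∑ j, ∑ k, Real.cos (rht ℓ m p.1 x j k + p.2 j k) *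
                Real.cos (rht ℓ m p.1 y j k + p.2 j k) -
            Real.exp (-‖x - y‖ ^ 2 / 2)| ≤ ε} + ENNReal.ofReal δ := by
    rw [← measure_univ (μ := μ)]
    refine (measure_mono hcover).trans ((measure_union_le _ _).trans ?_)
    gcongr
    refine (measure_union_le _ _).trans ((add_le_add hB₁ hB₂).trans ?_)
    rw [← ENNReal.ofReal_add (by linarith) (by linarith),
      ← ENNReal.ofReal_add (by linarith) (by linarith)]
    exact ENNReal.ofReal_le_ofReal (by linarith)
  rw [ENNReal.ofReal_sub _ hδ0.le, ENNReal.ofReal_one]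
  exact tsub_le_iff_right.2 hone
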